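/- arXiv:1503.06290 — 2 statements merged into one kernel-verified Lean document; each statement's English description precedes it below -/
import Mathlib

section
/- Let ν, μ ∈ ℂ with Re ν < 0 and Re μ < 1, and let z ∈ ℂ. Then (∫₀^∞ e^(z·s − s²/2) s^(−ν−1) ds) · (∫₀^∞ e^(−z·t − t²/2) t^(−ν−μ) dt) = (2^(1−μ/2) · Γ(1−ν−μ)/Γ(1−μ)) · e^(z²/2) · ∫₀^∞ e^((2ν+μ)·t − (z²/2)·tanh t) · (sinh 2t)^(−μ/2) · (∫₀^∞ e^(−z·√(tanh t)·u − u²/2) u^(−μ) du) dt. (This is Corollary 2, eq. (48): D_ν(−z)·D_(ν+μ−1)(z) = (2^(1−μ/2)/Γ(−ν)) ∫₀^∞ e^((2ν+μ)t − (z²/4)tanh t) · D_(μ−1)(z√(tanh t)) · (sinh 2t)^(−μ/2) dt, written with each parabolic cylinder function replaced by its Laplace-integral representation.) -/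
open MeasureTheory Complex Set

lemma aux_subst {E : Type*} [NormedAddCommGroup E] [NormedSpace ℝ E] (q : ℝ) (hq : 0 < q) (f : ℝ → E) :
    ∫ s in Ioi (0:ℝ), (1 + q / s^2) • f (s - q / s) = ∫ w, f w := by
  have hd : ∀ s ∈ Ioi (0:ℝ), HasDerivWithinAt (fun s : ℝ => s - q / s) (1 + q / s^2) (Ioi 0) s := by
    intro s hs
    have hs' : s ≠ 0 := ne_of_gt hs
    have h := ((hasDerivAt_id s).sub ((hasDerivAt_inv hs').const_mul q)).hasDerivWithinAt (s := Ioi 0)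
    exact h.congr_deriv (by field_simp; ring)
  have hinj : InjOn (fun s : ℝ => s - q / s) (Ioi 0) := by
    intro s hs t ht h
    have hs' : 0 < s := hs
    have ht' : 0 < t := ht
    simp only at h
    have h2 : (s - t) * (s * t + q) = 0 := by
      field_simp at h
      linear_combination h
    rcases mul_eq_zero.1 h2 with h3 | h3
    · linarith
    · have : 0 < s * t := by positivity
      linarith
  have him : (fun s : ℝ => s - q / s) '' (Ioi 0) = univ := by
    apply eq_univ_of_forall
    intro w
    have hR : 0 ≤ w^2 + 4 * q := by positivity
    have h1 : |w| < √(w^2 + 4*q) := by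
      rw [← Real.sqrt_sq_eq_abs]
      exact Real.sqrt_lt_sqrt (sq_nonneg _) (by linarith)
    have h2 : 0 < w + √(w^2 + 4*q) := by linarith [neg_abs_le w]
    refine ⟨(w + √(w^2 + 4*q)) / 2, by simpa using h2, ?_⟩
    have h3 := Real.sq_sqrt hR
    simp only
    field_simp
    nlinarith
  have := integral_image_eq_integral_abs_deriv_smul measurableSet_Ioi hd hinj f
  rw [him, setIntegral_univ] at this
  rw [this]
  refine setIntegral_congr_fun measurableSet_Ioi fun s hs => ?_
  have : 0 < 1 + q / s^2 := by positivity
  simp only [abs_of_pos this]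

lemma aux_glasser (α θ : ℝ) (hα : 0 < α) (hθ : 0 < θ) :
    ∫ y in Ioi (0:ℝ), Real.exp (-(θ^2 / y^2) - α^2 * y^2) =
      √Real.pi / (2 * α) * Real.exp (-(2 * α * θ)) := by
  set q := α * θ with hq
  have hq0 : 0 < q := by positivity
  have e1 : ∫ y in Ioi (0:ℝ), Real.exp (-(θ^2 / y^2) - α^2 * y^2) =
      α⁻¹ * ∫ s in Ioi (0:ℝ), Real.exp (-(s - q/s)^2) * Real.exp (-(2 * q)) := by
    have := integral_comp_mul_left_Ioi (fun s => Real.exp (-(s - q/s)^2) * Real.exp (-(2 * q))) 0 hα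
    rw [mul_zero, smul_eq_mul] at this
    rw [← this]
    refine setIntegral_congr_fun measurableSet_Ioi fun y hy => ?_
    have hy' : y ≠ 0 := ne_of_gt hy
    rw [← Real.exp_add]
    congr 1
    rw [hq]; field_simp; ring
  have e2 : ∫ s in Ioi (0:ℝ), Real.exp (-(s - q/s)^2) = √Real.pi / 2 := by
    have h := aux_subst q hq0 (fun w => Real.exp (-w^2) * ((w + √(w^2+4*q)) / (2 * √(w^2+4*q))))
    have e3 : ∫ s in Ioi (0:ℝ), Real.exp (-(s - q/s)^2) = ∫ w : ℝ, Real.exp (-w^2) * ((w + √(w^2+4*q)) / (2 * √(w^2+4*q))) := by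
      rw [← h]
      refine setIntegral_congr_fun measurableSet_Ioi fun s hs => ?_
      have hs' : 0 < s := hs
      have : √((s - q/s)^2+4*q) = s + q / s := by
        rw [show (s - q/s)^2+4*q = (s + q/s)^2 by field_simp; ring]
        exact Real.sqrt_sq (by positivity)
      simp only [this, smul_eq_mul]
      field_simp
      ring
    rw [e3]
    have hpos : ∀ w : ℝ, 0 < √(w^2+4*q) := fun w => by positivity
    have i1 : Integrable (fun w : ℝ => Real.exp (-w^2)) := by
      simpa using integrable_exp_neg_mul_sq (b := 1) one_pos
    have i2 : Integrable (fun w : ℝ => Real.exp (-w^2) * (w / √(w^2+4*q))) := by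
      refine i1.mono ?_ (Filter.Eventually.of_forall fun w => ?_)
      · exact (by fun_prop : Measurable _).aestronglyMeasurable
      · rw [norm_mul]
        refine mul_le_of_le_one_right (norm_nonneg _) ?_
        rw [Real.norm_eq_abs, abs_div, abs_of_pos (hpos w), div_le_one (hpos w), ← Real.sqrt_sq_eq_abs]
        exact Real.sqrt_le_sqrt (by linarith)
    have hodd : ∫ w : ℝ, Real.exp (-w^2) * (w / √(w^2+4*q)) = 0 := by
      have := integral_neg_eq_self (fun w : ℝ => Real.exp (-w^2) * (w / √(w^2+4*q))) volume
      simp only [neg_sq, neg_div, mul_neg, integral_neg] at this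
      linarith
    have : ∀ w : ℝ, Real.exp (-w^2) * ((w + √(w^2+4*q)) / (2 * √(w^2+4*q))) =
        (1/2) * Real.exp (-w^2) + (1/2) * (Real.exp (-w^2) * (w / √(w^2+4*q))) := by
      intro w
      have := (hpos w).ne'
      field_simp
      ring
    simp_rw [this]
    rw [integral_add (i1.const_mul _) (i2.const_mul _), integral_const_mul, integral_const_mul, hodd]
    have := integral_gaussian 1
    simp at this
    rw [this]; ring
  rw [e1, integral_mul_const, e2, hq]
  rw [mul_assoc 2 α θ]
  field_simp

lemma aux_key (z : ℂ) (p θ : ℝ) (hp : 0 < p) (hθ : 0 < θ) :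
    ∫ s in Ioi (0:ℝ), cexp (z * (s - p / s) - ((s:ℂ)^2 + (p / s)^2) / 2 - 2 * s * θ) / s =
    ∫ y in Ioi (0:ℝ), cexp ((z - θ)^2 / (2 + (y:ℂ)^2) - (θ:ℂ)^2 / (y:ℂ)^2 - (1 + (y:ℂ)^2) * p) *
      ((2 / √(2 + y^2) : ℝ) : ℂ) := by
  have hpi : ((√Real.pi : ℝ) : ℂ) ≠ 0 := by
    exact_mod_cast (Real.sqrt_pos.2 Real.pi_pos).ne'
  let F : ℝ → ℝ → ℂ := fun w y =>
    cexp ((z - θ) * w - (w:ℂ)^2 / 2 - p - (w:ℂ)^2 * (y:ℂ)^2 / 4) * (Real.exp (-(θ^2 / y^2) - p * y^2) : ℝ)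
  have hint : Integrable (Function.uncurry F) (volume.prod (volume.restrict (Ioi (0:ℝ)))) := by
    have i1 : Integrable (fun w : ℝ => cexp (-(1/2:ℂ) * (w:ℂ)^2 + (z - θ) * w + (-p))) :=
      integrable_cexp_quadratic (by norm_num) _ _
    have i2 : Integrable (fun y : ℝ => ((Real.exp (-p * y^2) : ℝ) : ℂ)) (volume.restrict (Ioi (0:ℝ))) :=
      ((integrable_exp_neg_mul_sq hp).ofReal).restrict
    refine (i1.mul_prod i2).mono ?_ (Filter.Eventually.of_forall ?_)
    · refine Measurable.aestronglyMeasurable ?_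
      simp only [F, Function.uncurry_def]
      fun_prop
    · rintro ⟨w, y⟩
      simp only [F, Function.uncurry_apply_pair, norm_mul]
      refine mul_le_mul ?_ ?_ (norm_nonneg _) (norm_nonneg _)
      · rw [Complex.norm_exp, Complex.norm_exp]
        apply Real.exp_le_exp.2
        have : ((w:ℂ)^2 * (y:ℂ)^2 / 4).re = w^2 * y^2 / 4 := by
          rw [show ((w:ℂ)^2 * (y:ℂ)^2 / 4) = ((w^2 * y^2 / 4 : ℝ) : ℂ) by push_cast; rfl, ofReal_re]
        rw [Complex.sub_re, this, show (-(1/2:ℂ) * (w:ℂ)^2 + (z - θ) * w + (-p)) = (z - θ) * w - (w:ℂ)^2 / 2 - p by ring]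
        have : 0 ≤ w^2 * y^2 / 4 := by positivity
        linarith
      · rw [Complex.norm_real, Complex.norm_real, Real.norm_eq_abs, Real.norm_eq_abs, Real.abs_exp, Real.abs_exp]
        apply Real.exp_le_exp.2
        have : 0 ≤ θ^2 / y^2 := by positivity
        linarith
  have hy : ∀ y ∈ Ioi (0:ℝ), ∫ w, F w y = (√Real.pi : ℝ) * (cexp ((z - θ)^2 / (2 + (y:ℂ)^2) - (θ:ℂ)^2 / (y:ℂ)^2 - (1 + (y:ℂ)^2) * p) *
      ((2 / √(2 + y^2) : ℝ) : ℂ)) := by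
    intro y hy
    have hy0 : 0 < y := hy
    have hb : (-(((2 + y^2) / 4 : ℝ) : ℂ)).re < 0 := by
      rw [neg_re, ofReal_re]
      have : 0 < (2 + y^2)/4 := by positivity
      linarith
    have h := integral_cexp_quadratic hb (z - θ) (-p)
    have e : ∀ w : ℝ, F w y = cexp (-(((2 + y^2) / 4 : ℝ) : ℂ) * (w:ℂ)^2 + (z - θ) * w + (-p)) * (Real.exp (-(θ^2 / y^2) - p * y^2) : ℝ) := by
      intro w
      simp only [F]
      congr 2
      push_cast; ring
    simp_rw [e]
    rw [integral_mul_const, h, neg_neg]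
    have e2 : ((Real.pi:ℂ) / (((2 + y^2) / 4 : ℝ) : ℂ)) ^ (1/2 : ℂ) = ((√Real.pi : ℝ) : ℂ) * ((2 / √(2 + y^2) : ℝ) : ℂ) := by
      rw [← ofReal_div, ← ofReal_mul, show (1/2 : ℂ) = ((1/2 : ℝ) : ℂ) by push_cast; rfl, ← ofReal_cpow (by positivity),
        ← Real.sqrt_eq_rpow]
      congr 1
      rw [Real.sqrt_div Real.pi_pos.le, Real.sqrt_div (by positivity), show (4:ℝ) = 2^2 by norm_num, Real.sqrt_sq (by norm_num)]
      field_simp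
    rw [e2]
    have e3 : cexp (-p - (z - θ)^2 / (4 * -(((2 + y^2) / 4 : ℝ) : ℂ))) * ((Real.exp (-(θ^2 / y^2) - p * y^2) : ℝ) : ℂ)
       = cexp ((z - θ)^2 / (2 + (y:ℂ)^2) - (θ:ℂ)^2 / (y:ℂ)^2 - (1 + (y:ℂ)^2) * p) := by
      rw [ofReal_exp, ← Complex.exp_add]
      congr 1
      have : (2 + (y:ℂ)^2) ≠ 0 := by
        have : (2 + y^2) ≠ 0 := by positivity
        exact_mod_cast this
      have hy1 : (y:ℂ) ≠ 0 := by exact_mod_cast hy0.ne'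
      push_cast
      field_simp
      ring
    rw [← e3]
    ring
  have hw : ∀ w : ℝ, ∫ y in Ioi (0:ℝ), F w y = (√Real.pi : ℝ) * (cexp ((z - θ) * w - (w:ℂ)^2 / 2 - p - √(w^2 + 4 * p) * θ) / √(w^2 + 4 * p)) := by
    intro w
    have hR : 0 < √(w^2 + 4*p) := by positivity
    have hR2 : √(w^2+4*p)^2 = w^2 + 4*p := Real.sq_sqrt (by positivity)
    set R := √(w^2 + 4*p)
    have h := aux_glasser (R/2) θ (by positivity) hθ
    have e : ∀ y : ℝ, F w y = cexp ((z - θ) * w - (w:ℂ)^2 / 2 - p) * ((Real.exp (-(θ^2 / y^2) - (R/2)^2 * y^2) : ℝ) : ℂ) := by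
      intro y
      simp only [F]
      rw [div_pow, hR2, ofReal_exp, ofReal_exp, ← Complex.exp_add, ← Complex.exp_add]
      congr 1
      push_cast; ring
    simp_rw [e]
    rw [integral_const_mul, integral_complex_ofReal, h]
    have hR' : (R:ℂ) ≠ 0 := by exact_mod_cast hR.ne'
    rw [sub_eq_add_neg _ ((R:ℂ) * θ), Complex.exp_add, show (2 * (R/2) * θ) = R * θ by ring]
    push_cast
    field_simp
  have hs : ∫ s in Ioi (0:ℝ), cexp (z * (s - p / s) - ((s:ℂ)^2 + (p / s)^2) / 2 - 2 * s * θ) / s =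
      ∫ w : ℝ, (cexp ((z - θ) * w - (w:ℂ)^2 / 2 - p - √(w^2 + 4 * p) * θ) / √(w^2 + 4 * p)) := by
    rw [← aux_subst p hp]
    refine setIntegral_congr_fun measurableSet_Ioi fun s hs => ?_
    have hs' : 0 < s := hs
    have : √((s - p/s)^2+4*p) = s + p / s := by
      rw [show (s - p/s)^2+4*p = (s + p/s)^2 by field_simp; ring]
      exact Real.sqrt_sq (by positivity)
    have hsc : (s:ℂ) ≠ 0 := by exact_mod_cast hs'.ne'
    have hsp : (s:ℂ)^2 + p ≠ 0 := by
      have : s^2 + p ≠ 0 := by positivity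
      exact_mod_cast this
    simp only [this]
    rw [Complex.real_smul, show (z * (s - p / s) - ((s:ℂ)^2 + (p / s)^2) / 2 - 2 * s * θ) = (z - θ) * ((s - p/s : ℝ):ℂ) - ((s - p/s : ℝ):ℂ)^2 / 2 - p - ((s + p/s : ℝ) : ℂ) * θ by
      push_cast; field_simp; ring]
    push_cast
    field_simp
  have hsw := integral_integral_swap hint
  rw [hs]
  simp_rw [hw] at hsw
  rw [setIntegral_congr_fun measurableSet_Ioi hy, integral_const_mul, integral_const_mul] at hsw
  exact mul_left_cancel₀ hpi hsw

lemma aux_int (x k : ℂ) (hk : 0 < k.re) :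
    IntegrableOn (fun u : ℝ => cexp (x * u - (u:ℂ)^2 / 2) * (u:ℂ)^(k - 1)) (Ioi 0) := by
  have h := (integrableOn_rpow_mul_exp_neg_mul_sq (b := 1/4) (by norm_num) (s := k.re - 1) (by linarith)).const_mul (Real.exp (x.re^2))
  refine Integrable.mono' h ?_ ?_
  · exact (by fun_prop : Measurable _).aestronglyMeasurable
  · refine (ae_restrict_iff' measurableSet_Ioi).2 (Filter.Eventually.of_forall fun u hu => ?_)
    have hu0 : 0 < u := hu
    rw [norm_mul, Complex.norm_exp, Complex.norm_cpow_eq_rpow_re_of_pos hu0]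
    have e1 : (x * u - (u:ℂ)^2/2).re = x.re * u - u^2/2 := by
      rw [show (u:ℂ)^2/2 = ((u^2/2 : ℝ):ℂ) by push_cast; rfl, sub_re, re_mul_ofReal, ofReal_re]
    rw [e1, sub_re, one_re, mul_left_comm, ← Real.exp_add, mul_comm]
    gcongr
    nlinarith [sq_nonneg (x.re - u/2)]

lemma aux_scale (A g : ℝ → ℂ) (c : ℂ) (r : ℝ) (hr : 0 < r)
    (h : ∀ p : ℝ, 0 < p → A p = c * g (r * p)) (hg : IntegrableOn g (Ioi 0)) :
    IntegrableOn A (Ioi 0) ∧ (∫ p in Ioi (0:ℝ), A p = c * (r:ℂ)⁻¹ * ∫ u in Ioi (0:ℝ), g u) ∧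
    (∫ p in Ioi (0:ℝ), ‖A p‖ = ‖c‖ * r⁻¹ * ∫ u in Ioi (0:ℝ), ‖g u‖) := by
  refine ⟨?_, ?_, ?_⟩
  · have := (integrableOn_Ioi_comp_mul_left_iff g 0 hr).2 (by simpa using hg)
    exact IntegrableOn.congr_fun (this.const_mul c) (fun p hp => (h p hp).symm) measurableSet_Ioi
  · rw [setIntegral_congr_fun measurableSet_Ioi (fun p hp => h p hp), integral_const_mul,
      integral_comp_mul_left_Ioi g 0 hr, mul_zero, Complex.real_smul, ofReal_inv, mul_assoc]
  · rw [setIntegral_congr_fun (g := fun p => ‖c‖ * ‖g (r * p)‖) measurableSet_Ioi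
      (fun p hp => by simp only [h p hp, norm_mul]), integral_const_mul,
      integral_comp_mul_left_Ioi (fun u => ‖g u‖) 0 hr, mul_zero, smul_eq_mul, mul_assoc]

lemma aux_fub (A B : ℝ → ℝ → ℂ) (M : ℝ → ℝ)
    (hA : Measurable (Function.uncurry A)) (hB : Measurable (Function.uncurry B))
    (iA : ∀ s : ℝ, 0 < s → IntegrableOn (A s) (Ioi 0)) (iB : ∀ s : ℝ, 0 < s → IntegrableOn (B s) (Ioi 0))
    (hM : IntegrableOn M (Ioi 0))
    (hb : ∀ s : ℝ, 0 < s → (∫ p in Ioi (0:ℝ), ‖A s p‖) * (∫ p in Ioi (0:ℝ), ‖B s p‖) ≤ M s) :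
    ∫ s in Ioi (0:ℝ), (∫ p in Ioi (0:ℝ), A s p) * (∫ q in Ioi (0:ℝ), B s q) =
    ∫ x in (Ioi (0:ℝ)) ×ˢ (Ioi (0:ℝ)), ∫ s in Ioi (0:ℝ), A s x.1 * B s x.2 := by
  have hmeas : Measurable (Function.uncurry (fun (s : ℝ) (x : ℝ × ℝ) => A s x.1 * B s x.2)) := by
    have h1 : Measurable (fun y : ℝ × (ℝ × ℝ) => Function.uncurry A (y.1, y.2.1)) := hA.comp (by fun_prop)
    have h2 : Measurable (fun y : ℝ × (ℝ × ℝ) => Function.uncurry B (y.1, y.2.2)) := hB.comp (by fun_prop)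
    exact h1.mul h2
  have hint : Integrable (Function.uncurry (fun (s : ℝ) (x : ℝ × ℝ) => A s x.1 * B s x.2))
      ((volume.restrict (Ioi (0:ℝ))).prod ((volume.restrict (Ioi (0:ℝ))).prod (volume.restrict (Ioi (0:ℝ))))) := by
    rw [integrable_prod_iff hmeas.aestronglyMeasurable]
    constructor
    · refine (ae_restrict_iff' measurableSet_Ioi).2 (Filter.Eventually.of_forall fun s hs => ?_)
      exact (iA s hs).mul_prod (iB s hs)
    · refine Integrable.mono' hM ?_ ?_
      · exact (hmeas.norm.stronglyMeasurable.integral_prod_right' ).aestronglyMeasurable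
      · refine (ae_restrict_iff' measurableSet_Ioi).2 (Filter.Eventually.of_forall fun s hs => ?_)
        rw [Real.norm_of_nonneg (by positivity)]
        simp only [Function.uncurry_apply_pair, norm_mul]
        rw [integral_prod_mul (fun p => ‖A s p‖) (fun p => ‖B s p‖)]
        exact hb s hs
  have := integral_integral_swap hint
  rw [Measure.volume_eq_prod, ← Measure.prod_restrict, ← this]
  refine integral_congr_ae (Filter.Eventually.of_forall fun s => ?_)
  simp only
  rw [integral_prod_mul (A s) (B s)]

lemma aux_gam (k : ℂ) (hk : 0 < k.re) :
    IntegrableOn (fun u : ℝ => (u:ℂ)^(k-1) * cexp (-u)) (Ioi 0) ∧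
    ∫ u in Ioi (0:ℝ), (u:ℂ)^(k-1) * cexp (-u) = Gamma k := by
  constructor
  · refine (Complex.GammaIntegral_convergent hk).congr_fun (fun u hu => ?_) measurableSet_Ioi
    simp only; push_cast; ring
  · rw [Gamma_eq_integral hk, GammaIntegral]
    refine setIntegral_congr_fun measurableSet_Ioi (fun u hu => ?_)
    push_cast; ring

lemma aux_cpow (x : ℝ) (hx : 0 < x) (w : ℂ) : (x:ℂ)^w = cexp ((Real.log x : ℝ) * w) := by
  rw [cpow_def_of_ne_zero (by exact_mod_cast hx.ne'), ofReal_log hx.le]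

lemma aux_lhs (a k z : ℂ) (ha : 0 < a.re) (hk : 0 < k.re) :
    (2:ℂ)^(-k) * Gamma k * ((∫ s in Ioi (0:ℝ), cexp (z * s - (s:ℂ)^2 / 2) * (s:ℂ)^(a - 1)) *
      ∫ t in Ioi (0:ℝ), cexp (-z * t - (t:ℂ)^2 / 2) * (t:ℂ)^(a + k - 1)) =
    ∫ x in (Ioi (0:ℝ)) ×ˢ (Ioi (0:ℝ)), ∫ s in Ioi (0:ℝ),
      (cexp (z * (s - x.1 / s) - ((s:ℂ)^2 + (x.1 / s)^2) / 2) * (x.1:ℂ)^(a + k - 1)) *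
      ((x.2:ℂ)^(k - 1) * cexp (-(2 * s * x.2)) / s) := by
  have hak : 0 < (a + k).re := by rw [add_re]; linarith
  have key1 := fun (s : ℝ) (hs : 0 < s) => aux_scale
    (fun p : ℝ => cexp (z * (s - p / s) - ((s:ℂ)^2 + (p / s)^2) / 2) * (p:ℂ)^(a + k - 1))
    (fun t : ℝ => cexp (-z * t - (t:ℂ)^2 / 2) * (t:ℂ)^(a + k - 1))
    (cexp (z * s - (s:ℂ)^2/2) * (s:ℂ)^(a + k - 1)) s⁻¹ (inv_pos.2 hs) (by
      intro p hp
      have e : (p:ℂ) = (s:ℂ) * ((s⁻¹ * p : ℝ) : ℂ) := by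
        rw [← ofReal_mul]; congr 1; field_simp
      have e2 : (p:ℂ)^(a+k-1) = (s:ℂ)^(a+k-1) * ((s⁻¹ * p : ℝ):ℂ)^(a+k-1) := by
        conv_lhs => rw [e]
        exact mul_cpow_ofReal_nonneg hs.le (by positivity) _
      rw [e2, mul_mul_mul_comm, ← Complex.exp_add]
      congr 2
      push_cast; ring) (aux_int (-z) (a + k) hak)
  have key2 := fun (s : ℝ) (hs : 0 < s) => aux_scale
    (fun q : ℝ => (q:ℂ)^(k - 1) * cexp (-(2 * s * q)) / s)
    (fun t : ℝ => (t:ℂ)^(k - 1) * cexp (-t))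
    (((2 * s : ℝ):ℂ)^(1 - k) / s) (2 * s) (by positivity) (by
      intro p hp
      rw [ofReal_mul (2*s) p, mul_cpow_ofReal_nonneg (by positivity) hp.le]
      have : ((2 * s : ℝ):ℂ)^(1 - k) * ((2 * s : ℝ):ℂ)^(k - 1) = 1 := by
        rw [← cpow_add _ _ (by exact_mod_cast (by positivity : 2 * s ≠ 0))]
        simp
      rw [show ((2 * s : ℝ):ℂ)^(1 - k) / s * (((2 * s : ℝ):ℂ)^(k - 1) * (p:ℂ)^(k-1) * cexp (-(((2*s:ℝ):ℂ) * p))) =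
        (((2 * s : ℝ):ℂ)^(1 - k) * ((2 * s : ℝ):ℂ)^(k - 1)) * ((p:ℂ)^(k-1) * cexp (-(((2*s:ℝ):ℂ) * p)) / s) by ring, this]
      push_cast; ring) (aux_gam k hk).1
  have hc : ∀ s : ℝ, 0 < s → (cexp (z * s - (s:ℂ)^2/2) * (s:ℂ)^(a + k - 1) * ((s⁻¹ : ℝ):ℂ)⁻¹) *
      (((2 * s : ℝ):ℂ)^(1 - k) / s * ((2 * s : ℝ):ℂ)⁻¹) = (2:ℂ)^(-k) * (cexp (z * s - (s:ℂ)^2 / 2) * (s:ℂ)^(a - 1)) := by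
    intro s hs
    have hs' : (s:ℂ) ≠ 0 := by exact_mod_cast hs.ne'
    have e1 : ((2 * s : ℝ):ℂ)^(1 - k) * ((2 * s : ℝ):ℂ)⁻¹ = (2:ℂ)^(-k) * (s:ℂ)^(-k) := by
      rw [← cpow_neg_one, ← cpow_add _ _ (by exact_mod_cast (by positivity : 2 * s ≠ 0)), ofReal_mul,
        mul_cpow_ofReal_nonneg (by norm_num) hs.le, show 1 - k + -1 = -k by ring]
      norm_num
    have e2 : (s:ℂ)^(a + k - 1) * (s:ℂ)^(-k) = (s:ℂ)^(a-1) := by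
      rw [← cpow_add _ _ hs']; congr 1; ring
    rw [ofReal_inv, inv_inv, ← e2]
    calc _ = cexp (z * s - (s:ℂ)^2/2) * (s:ℂ)^(a + k - 1) * (s / s) * (((2 * s : ℝ):ℂ)^(1 - k) * ((2 * s : ℝ):ℂ)⁻¹) := by ring
      _ = _ := by rw [e1, div_self hs']; ring
  have hf := aux_int z a ha
  have hMi : IntegrableOn (fun s : ℝ => ‖(2:ℂ)^(-k) * (cexp (z * s - (s:ℂ)^2 / 2) * (s:ℂ)^(a - 1))‖ *
      ((∫ t in Ioi (0:ℝ), ‖cexp (-z * t - (t:ℂ)^2 / 2) * (t:ℂ)^(a + k - 1)‖) *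
      (∫ t in Ioi (0:ℝ), ‖(t:ℂ)^(k - 1) * cexp (-t)‖))) (Ioi 0) :=
    Integrable.mul_const (Integrable.norm (Integrable.const_mul hf ((2:ℂ)^(-k)))) _
  rw [← aux_fub (fun s p => cexp (z * (s - p / s) - ((s:ℂ)^2 + (p / s)^2) / 2) * (p:ℂ)^(a + k - 1))
    (fun s q => (q:ℂ)^(k - 1) * cexp (-(2 * s * q)) / s)
    (fun s => ‖(2:ℂ)^(-k) * (cexp (z * s - (s:ℂ)^2 / 2) * (s:ℂ)^(a - 1))‖ *
      ((∫ t in Ioi (0:ℝ), ‖cexp (-z * t - (t:ℂ)^2 / 2) * (t:ℂ)^(a + k - 1)‖) *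
      (∫ t in Ioi (0:ℝ), ‖(t:ℂ)^(k - 1) * cexp (-t)‖)))
    (by simp only [Function.uncurry_def]; fun_prop) (by simp only [Function.uncurry_def]; fun_prop)
    (fun s hs => (key1 s hs).1) (fun s hs => (key2 s hs).1) hMi ?_]
  · refine Eq.trans ?_ (setIntegral_congr_fun (g := fun s : ℝ => (2:ℂ)^(-k) * (cexp (z * s - (s:ℂ)^2 / 2) * (s:ℂ)^(a - 1)) *
      ((∫ t in Ioi (0:ℝ), cexp (-z * t - (t:ℂ)^2 / 2) * (t:ℂ)^(a + k - 1)) * Gamma k)) measurableSet_Ioi ?_).symm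
    · rw [integral_mul_const, integral_const_mul]; ring
    · intro s hs
      simp only
      rw [(key1 s hs).2.1, (key2 s hs).2.1, (aux_gam k hk).2, ← hc s hs]
      ring
  · intro s hs
    have hs0 : 0 < s := hs
    rw [(key1 s hs).2.2, (key2 s hs).2.2, ← hc s hs]
    simp only [norm_mul, norm_inv, norm_div, Complex.norm_real, Real.norm_eq_abs]
    apply le_of_eq
    simp only [abs_of_pos hs0, abs_inv, abs_two, abs_mul]
    ring

lemma aux_rhs (a k z : ℂ) (ha : 0 < a.re) (hk : 0 < k.re) :
    (∫ y in Ioi (0:ℝ), (((1 + y^2 : ℝ):ℂ)^(1 - (a + k)) * ((1 + y^2 : ℝ):ℂ)⁻¹ * Gamma (a + k)) *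
      (cexp (z^2 / ((2 + y^2 : ℝ):ℂ)) * ((y * √(2 + y^2) / 2 : ℝ):ℂ)^(k - 1) * ((2 / √(2 + y^2) : ℝ):ℂ) *
        (((y * √(2 + y^2) / 2)⁻¹ : ℝ):ℂ)⁻¹ *
        ∫ u in Ioi (0:ℝ), cexp (-z * ((y / √(2 + y^2) : ℝ):ℂ) * u - (u:ℂ)^2 / 2) * (u:ℂ)^(k - 1))) =
    ∫ x in (Ioi (0:ℝ)) ×ˢ (Ioi (0:ℝ)), ∫ y in Ioi (0:ℝ),
      ((x.1:ℂ)^(a + k - 1) * cexp (-((1 + (y:ℂ)^2) * x.1))) *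
      ((x.2:ℂ)^(k - 1) * cexp ((z - x.2)^2 / (2 + (y:ℂ)^2) - (x.2:ℂ)^2 / (y:ℂ)^2) * ((2 / √(2 + y^2) : ℝ):ℂ)) := by
  have hak : 0 < (a + k).re := by rw [add_re]; linarith
  have key1 := fun (y : ℝ) (_ : 0 < y) => aux_scale
    (fun p : ℝ => (p:ℂ)^(a + k - 1) * cexp (-((1 + (y:ℂ)^2) * p)))
    (fun t : ℝ => (t:ℂ)^(a + k - 1) * cexp (-t))
    (((1 + y^2 : ℝ):ℂ)^(1 - (a + k))) (1 + y^2) (by positivity) (by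
      intro p hp
      rw [ofReal_mul (1 + y^2) p, mul_cpow_ofReal_nonneg (by positivity) hp.le]
      have : ((1 + y^2 : ℝ):ℂ)^(1 - (a + k)) * ((1 + y^2 : ℝ):ℂ)^(a + k - 1) = 1 := by
        rw [← cpow_add _ _ (by exact_mod_cast (by positivity : 1 + y^2 ≠ 0))]
        simp
      rw [← mul_assoc, ← mul_assoc, this, one_mul]
      push_cast; ring) (aux_gam (a + k) hak).1
  have key2 := fun (y : ℝ) (hy : 0 < y) => aux_scale
    (fun q : ℝ => (q:ℂ)^(k - 1) * cexp ((z - q)^2 / (2 + (y:ℂ)^2) - (q:ℂ)^2 / (y:ℂ)^2) * ((2 / √(2 + y^2) : ℝ):ℂ))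
    (fun u : ℝ => cexp (-z * ((y / √(2 + y^2) : ℝ):ℂ) * u - (u:ℂ)^2 / 2) * (u:ℂ)^(k - 1))
    (cexp (z^2 / ((2 + y^2 : ℝ):ℂ)) * ((y * √(2 + y^2) / 2 : ℝ):ℂ)^(k - 1) * ((2 / √(2 + y^2) : ℝ):ℂ))
    (y * √(2 + y^2) / 2)⁻¹ (by positivity) (by
      intro p hp
      have hS : 0 < √(2 + y^2) := by positivity
      have hS2 : √(2 + y^2)^2 = 2 + y^2 := Real.sq_sqrt (by positivity)
      rw [← hS2]
      have hS2' : (2 + (y:ℂ)^2) = ((√(2 + y^2) : ℝ):ℂ)^2 := by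
        have := congrArg (fun x : ℝ => (x:ℂ)) hS2
        push_cast at this
        exact this.symm
      rw [hS2']
      rw [Real.sqrt_sq hS.le]
      set S := √(2 + y^2)
      set d := y * S / 2 with hd
      have hd0 : 0 < d := by positivity
      have e : (p:ℂ) = (d:ℂ) * ((d⁻¹ * p : ℝ) : ℂ) := by
        rw [← ofReal_mul]; congr 1; field_simp
      have e2 : (p:ℂ)^(k-1) = (d:ℂ)^(k-1) * ((d⁻¹ * p : ℝ):ℂ)^(k-1) := by
        conv_lhs => rw [e]
        exact mul_cpow_ofReal_nonneg hd0.le (by positivity) _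
      have hSc : (S:ℂ) ≠ 0 := by exact_mod_cast hS.ne'
      have hyc : (y:ℂ) ≠ 0 := by exact_mod_cast hy.ne'
      have e3 : cexp ((z - p)^2 / (S:ℂ)^2 - (p:ℂ)^2 / (y:ℂ)^2) =
          cexp (z^2 / ((S^2 : ℝ):ℂ)) * cexp (-z * ((y / S : ℝ):ℂ) * ((d⁻¹ * p : ℝ):ℂ) - ((d⁻¹ * p : ℝ):ℂ)^2 / 2) := by
        rw [← Complex.exp_add]
        congr 1
        rw [hd]
        push_cast
        field_simp
        rw [← hS2']
        ring
      rw [e2, e3]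
      ring) (by
        have := aux_int (-z * ((y / √(2 + y^2) : ℝ):ℂ)) k hk
        exact this)
  have hgb : ∀ y : ℝ, 0 < y →
      ∫ u in Ioi (0:ℝ), ‖cexp (-z * ((y / √(2 + y^2) : ℝ):ℂ) * u - (u:ℂ)^2 / 2) * (u:ℂ)^(k - 1)‖ ≤
      ∫ u in Ioi (0:ℝ), ‖cexp ((|z.re| : ℝ) * u - (u:ℂ)^2 / 2) * (u:ℂ)^(k - 1)‖ := by
    intro y hy
    have i1 := aux_int (-z * ((y / √(2 + y^2) : ℝ):ℂ)) k hk
    have i2 := aux_int ((|z.re| : ℝ)) k hk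
    refine setIntegral_mono_on i1.norm i2.norm measurableSet_Ioi fun u hu => ?_
    have hu0 : 0 < u := hu
    rw [norm_mul, norm_mul]
    refine mul_le_mul_of_nonneg_right ?_ (norm_nonneg _)
    rw [Complex.norm_exp, Complex.norm_exp]
    apply Real.exp_le_exp.2
    rw [sub_re, sub_re, re_mul_ofReal, re_mul_ofReal, re_mul_ofReal, ofReal_re, neg_re]
    have h1 : y / √(2 + y^2) ≤ 1 := by
      rw [div_le_one (by positivity)]
      exact Real.le_sqrt_of_sq_le (by linarith)
    have h0 : 0 ≤ y / √(2 + y^2) := by positivity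
    have h2 : -z.re * (y / √(2 + y^2)) ≤ |z.re| := by
      calc -z.re * (y / √(2 + y^2)) ≤ |z.re| * (y / √(2 + y^2)) := by
            gcongr; exact neg_le_abs _
        _ ≤ |z.re| * 1 := by gcongr
        _ = |z.re| := mul_one _
    have := mul_le_mul_of_nonneg_right h2 hu0.le
    linarith
  set K1 := ∫ u in Ioi (0:ℝ), ‖cexp ((|z.re| : ℝ) * u - (u:ℂ)^2 / 2) * (u:ℂ)^(k - 1)‖ with hK1
  have hK1n : 0 ≤ K1 := by positivity
  set K2 := ∫ t in Ioi (0:ℝ), ‖(t:ℂ)^(a + k - 1) * cexp (-t)‖ with hK2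
  have hK2n : 0 ≤ K2 := by positivity
  have hMi : IntegrableOn (fun y : ℝ => (K2 * (Real.exp (‖z‖^2) * 2 * (2:ℝ)^(-k.re) * K1)) * (1 + ‖y‖^2)^(-(1 + 2 * a.re) / 2)) (Ioi 0) := by
    refine Integrable.const_mul (Integrable.restrict ?_) _
    apply integrable_rpow_neg_one_add_norm_sq
    simp
    linarith
  rw [← aux_fub (fun y p => (p:ℂ)^(a + k - 1) * cexp (-((1 + (y:ℂ)^2) * p)))
    (fun y q => (q:ℂ)^(k - 1) * cexp ((z - q)^2 / (2 + (y:ℂ)^2) - (q:ℂ)^2 / (y:ℂ)^2) * ((2 / √(2 + y^2) : ℝ):ℂ))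
    _ (by simp only [Function.uncurry_def]; fun_prop) (by simp only [Function.uncurry_def]; fun_prop)
    (fun s hs => (key1 s hs).1) (fun s hs => (key2 s hs).1) hMi ?_]
  · refine setIntegral_congr_fun measurableSet_Ioi ?_
    intro y hy
    simp only
    rw [(key1 y hy).2.1, (key2 y hy).2.1, (aux_gam (a + k) hak).2, ofReal_inv]
  · intro y hy
    rw [(key1 y hy).2.2, (key2 y hy).2.2]
    have hP : 0 < 1 + y^2 := by positivity
    have hS : 0 < √(2 + y^2) := by positivity
    have hS2 : √(2 + y^2)^2 = 2 + y^2 := Real.sq_sqrt (by positivity)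
    have hd0 : 0 < y * √(2 + y^2) / 2 := by positivity
    have b1 : ‖cexp (z^2 / ((2 + y^2 : ℝ):ℂ))‖ ≤ Real.exp (‖z‖^2) := by
      refine (Complex.norm_exp_le_exp_norm _).trans (Real.exp_le_exp.2 ?_)
      rw [norm_div, norm_pow, Complex.norm_real, Real.norm_of_nonneg (by positivity)]
      exact div_le_self (by positivity) (by nlinarith)
    have b2 : (y * √(2 + y^2) / 2)^(k.re - 1) * (y * √(2 + y^2) / 2) ≤ (2:ℝ)^(-k.re) * (1 + y^2)^k.re := by
      rw [← Real.rpow_add_one hd0.ne', sub_add_cancel, Real.div_rpow (by positivity) (by norm_num), Real.rpow_neg (by norm_num), div_eq_inv_mul]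
      gcongr
      apply abs_le_of_sq_le_sq' _ (by positivity) |>.2
      rw [mul_pow, hS2]; nlinarith
    have b3 : 2 / √(2 + y^2) ≤ 2 * (1 + y^2)^(-(1/2:ℝ)) := by
      rw [Real.rpow_neg hP.le, ← Real.sqrt_eq_rpow, div_eq_mul_inv]
      gcongr
      linarith
    simp only [norm_mul, Complex.norm_real]
    rw [Complex.norm_cpow_eq_rpow_re_of_pos hP, Complex.norm_cpow_eq_rpow_re_of_pos hd0]
    have e1 : (1 + y^2)^(1 - (a + k)).re * (1 + y^2)⁻¹ = (1 + y^2)^(-(a.re + k.re)) := by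
      rw [← Real.rpow_neg_one, ← Real.rpow_add hP]
      congr 1
      simp
      ring
    have e2 : (1 + y^2)^(-(a.re + k.re)) * ((1 + y^2)^k.re * (1 + y^2)^(-(1/2:ℝ))) = (1 + ‖y‖^2)^(-(1 + 2 * a.re) / 2) := by
      rw [← Real.rpow_add hP, ← Real.rpow_add hP, Real.norm_eq_abs, sq_abs]
      congr 1
      ring
    rw [← e2, e1, inv_inv, Real.norm_of_nonneg (by positivity : 0 ≤ 2 / √(2 + y^2)), sub_re, one_re]
    have hg := hgb y hy
    simp only [norm_mul] at hg hK1 hK2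
    set I := ∫ u in Ioi (0:ℝ), ‖cexp (-z * ((y / √(2 + y^2) : ℝ):ℂ) * u - (u:ℂ)^2 / 2)‖ * ‖(u:ℂ)^(k - 1)‖
    have hI : 0 ≤ I := by positivity
    clear_value I
    calc _ = (1 + y^2)^(-(a.re + k.re)) * K2 * (‖cexp (z^2 / ((2 + y^2 : ℝ):ℂ))‖ *
        ((y * √(2 + y^2) / 2)^(k.re - 1) * (y * √(2 + y^2) / 2)) * (2 / √(2 + y^2)) * I) := by ring
      _ ≤ (1 + y^2)^(-(a.re + k.re)) * K2 * (Real.exp (‖z‖^2) * ((2:ℝ)^(-k.re) * (1 + y^2)^k.re) * (2 * (1 + y^2)^(-(1/2:ℝ))) * K1) := by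
        gcongr
      _ = _ := by ring

lemma aux_tau (Φ : ℝ → ℂ) : ∫ y in Ioi (0:ℝ), Φ y =
    ∫ t in Ioi (0:ℝ), ((Real.exp (2 * t) / √(Real.exp (2 * t) - 1) : ℝ):ℂ) * Φ (√(Real.exp (2 * t) - 1)) := by
  have hpos : ∀ t ∈ Ioi (0:ℝ), 0 < Real.exp (2 * t) - 1 := by
    intro t ht
    have ht' : 0 < t := ht
    have := Real.one_lt_exp_iff.2 (by linarith : 0 < 2 * t)
    linarith
  have hd : ∀ t ∈ Ioi (0:ℝ), HasDerivWithinAt (fun t : ℝ => √(Real.exp (2 * t) - 1))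
      (Real.exp (2 * t) / √(Real.exp (2 * t) - 1)) (Ioi 0) t := by
    intro t ht
    have h1 : HasDerivAt (fun t : ℝ => Real.exp (2 * t) - 1) (Real.exp (2 * t) * 2) t := by
      have := ((hasDerivAt_id t).const_mul 2).exp.sub_const 1
      simpa using this
    have h2 := h1.sqrt (hpos t ht).ne'
    refine h2.hasDerivWithinAt.congr_deriv ?_
    have := Real.sqrt_pos.2 (hpos t ht)
    field_simp
  have hinj : InjOn (fun t : ℝ => √(Real.exp (2 * t) - 1)) (Ioi 0) := by
    intro s hs t ht h
    have h1 := (Real.sqrt_inj (hpos s hs).le (hpos t ht).le).1 h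
    have h2 : Real.exp (2 * s) = Real.exp (2 * t) := by linarith
    have := Real.exp_injective h2
    linarith
  have him : (fun t : ℝ => √(Real.exp (2 * t) - 1)) '' (Ioi 0) = Ioi 0 := by
    ext y
    constructor
    · rintro ⟨t, ht, rfl⟩
      exact Real.sqrt_pos.2 (hpos t ht)
    · intro hy
      have hy0 : 0 < y := hy
      have : 0 < y^2 := by positivity
      refine ⟨Real.log (1 + y^2) / 2, ?_, ?_⟩
      · exact div_pos (Real.log_pos (by linarith)) two_pos
      · simp only
        rw [mul_div_cancel₀ _ two_ne_zero, Real.exp_log (by positivity), add_sub_cancel_left, Real.sqrt_sq hy0.le]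
  have := integral_image_eq_integral_abs_deriv_smul measurableSet_Ioi hd hinj Φ
  rw [him] at this
  rw [this]
  refine setIntegral_congr_fun measurableSet_Ioi fun t ht => ?_
  have h := Real.sqrt_pos.2 (hpos t ht)
  rw [abs_of_pos (by positivity), Complex.real_smul]

/-- Corollary 2, eq. (48): `D_ν(-z) D_(ν+μ-1)(z) = (2^(1-μ/2)/Γ(-ν)) ∫₀^∞
e^((2ν+μ)t - (z²/4) tanh t) D_(μ-1)(z √(tanh t)) (sinh 2t)^(-μ/2) dt`, written with each
parabolic cylinder function replaced by its Laplace-integral representation. -/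
theorem nicholson_type_integral_opposite_argument
    (ν μ z : ℂ) (hν : ν.re < 0) (hμ : μ.re < 1) :
    (∫ s in Ioi (0:ℝ), Complex.exp (z * s - (s:ℂ)^2 / 2) * (s:ℂ) ^ (-ν - 1)) *
      (∫ t in Ioi (0:ℝ), Complex.exp (-z * t - (t:ℂ)^2 / 2) * (t:ℂ) ^ (-ν - μ)) =
    ((2:ℂ) ^ (1 - μ/2) * Complex.Gamma (1 - ν - μ) / Complex.Gamma (1 - μ)) *
      Complex.exp (z^2 / 2) *
      ∫ t in Ioi (0:ℝ),
        Complex.exp ((2 * ν + μ) * t - z^2 / 2 * (Real.tanh t : ℝ)) *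
          ((Real.sinh (2 * t) : ℝ) : ℂ) ^ (-μ/2) *
          (∫ u in Ioi (0:ℝ),
            Complex.exp (-z * (Real.sqrt (Real.tanh t) : ℝ) * u - (u:ℂ)^2 / 2) *
              (u:ℂ) ^ (-μ)) := by
  have ha : 0 < (-ν).re := by rw [neg_re]; linarith
  have hk : 0 < (1 - μ).re := by rw [sub_re, one_re]; linarith
  have hG : Gamma (1 - μ) ≠ 0 := Gamma_ne_zero_of_re_pos hk
  have L := aux_lhs (-ν) (1 - μ) z ha hk
  have R := aux_rhs (-ν) (1 - μ) z ha hk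
  have hLR : (∫ x in (Ioi (0:ℝ)) ×ˢ (Ioi (0:ℝ)), ∫ s in Ioi (0:ℝ),
      (cexp (z * (s - x.1 / s) - ((s:ℂ)^2 + (x.1 / s)^2) / 2) * (x.1:ℂ)^(-ν + (1 - μ) - 1)) *
      ((x.2:ℂ)^((1 - μ) - 1) * cexp (-(2 * s * x.2)) / s)) =
      ∫ x in (Ioi (0:ℝ)) ×ˢ (Ioi (0:ℝ)), ∫ y in Ioi (0:ℝ),
      ((x.1:ℂ)^(-ν + (1 - μ) - 1) * cexp (-((1 + (y:ℂ)^2) * x.1))) *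
      ((x.2:ℂ)^((1 - μ) - 1) * cexp ((z - x.2)^2 / (2 + (y:ℂ)^2) - (x.2:ℂ)^2 / (y:ℂ)^2) * ((2 / √(2 + y^2) : ℝ):ℂ)) := by
    refine setIntegral_congr_fun (measurableSet_Ioi.prod measurableSet_Ioi) ?_
    rintro ⟨p, q⟩ ⟨hp, hq⟩
    have key := aux_key z p q hp hq
    simp only
    trans (p:ℂ)^(-ν + (1 - μ) - 1) * (q:ℂ)^((1 - μ) - 1) * ∫ s in Ioi (0:ℝ), cexp (z * (s - p / s) - ((s:ℂ)^2 + (p / s)^2) / 2 - 2 * s * q) / s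
    · rw [← integral_const_mul]
      refine integral_congr_ae (Filter.Eventually.of_forall fun s => ?_)
      simp only
      rw [sub_eq_add_neg _ (2 * (s:ℂ) * q), Complex.exp_add]
      ring
    · rw [key, ← integral_const_mul]
      refine integral_congr_ae (Filter.Eventually.of_forall fun y => ?_)
      simp only
      rw [sub_eq_add_neg _ ((1 + (y:ℂ)^2) * p), Complex.exp_add]
      ring
  rw [hLR, ← R] at L
  replace L := L.trans (aux_tau _)
  have hb : -ν + (1 - μ) = 1 - ν - μ := by ring
  have hb1 : (1 - ν - μ) - 1 = -ν - μ := by ring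
  have hk1 : (1 - μ) - 1 = -μ := by ring
  rw [hb, hb1, hk1] at L
  have hpt : ∀ t ∈ Ioi (0:ℝ), ((Real.exp (2 * t) / √(Real.exp (2 * t) - 1) : ℝ):ℂ) *
      ((((1 + √(Real.exp (2 * t) - 1)^2 : ℝ):ℂ)^(1 - (1 - ν - μ)) * ((1 + √(Real.exp (2 * t) - 1)^2 : ℝ):ℂ)⁻¹ * Gamma (1 - ν - μ)) *
      (cexp (z^2 / ((2 + √(Real.exp (2 * t) - 1)^2 : ℝ):ℂ)) * ((√(Real.exp (2 * t) - 1) * √(2 + √(Real.exp (2 * t) - 1)^2) / 2 : ℝ):ℂ)^(-μ) * ((2 / √(2 + √(Real.exp (2 * t) - 1)^2) : ℝ):ℂ) *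
        (((√(Real.exp (2 * t) - 1) * √(2 + √(Real.exp (2 * t) - 1)^2) / 2)⁻¹ : ℝ):ℂ)⁻¹ *
        ∫ u in Ioi (0:ℝ), cexp (-z * ((√(Real.exp (2 * t) - 1) / √(2 + √(Real.exp (2 * t) - 1)^2) : ℝ):ℂ) * u - (u:ℂ)^2 / 2) * (u:ℂ)^(-μ))) =
      ((2:ℂ)^(μ/2) * Gamma (1 - ν - μ) * cexp (z^2/2)) * (Complex.exp ((2 * ν + μ) * t - z^2 / 2 * (Real.tanh t : ℝ)) *
          ((Real.sinh (2 * t) : ℝ) : ℂ) ^ (-μ/2) *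
          (∫ u in Ioi (0:ℝ),
            Complex.exp (-z * (Real.sqrt (Real.tanh t) : ℝ) * u - (u:ℂ)^2 / 2) *
              (u:ℂ) ^ (-μ))) := by
    intro t ht
    have ht0 : 0 < t := ht
    have hX1 : 1 < Real.exp (2 * t) := Real.one_lt_exp_iff.2 (by linarith)
    have hlog : Real.log (Real.exp (2 * t)) = 2 * t := Real.log_exp _
    have htanh : Real.tanh t = (Real.exp (2 * t) - 1) / (Real.exp (2 * t) + 1) := by
      rw [Real.tanh_eq_sinh_div_cosh, Real.sinh_eq, Real.cosh_eq, Real.exp_neg, show 2 * t = t + t by ring, Real.exp_add]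
      have := Real.exp_pos t
      field_simp
    have hsinh : Real.sinh (2 * t) = (Real.exp (2 * t)^2 - 1) / (2 * Real.exp (2 * t)) := by
      rw [Real.sinh_eq, Real.exp_neg]
      have := Real.exp_pos (2 * t)
      field_simp
    rw [htanh, hsinh]
    set X := Real.exp (2 * t)
    have hX0 : 0 < X := by linarith
    have hXm : 0 < X - 1 := by linarith
    have hX2 : 0 < X^2 - 1 := by nlinarith
    rw [Real.sq_sqrt hXm.le, show 1 + (X - 1) = X by ring, show 2 + (X - 1) = X + 1 by ring,
      Real.sqrt_div hXm.le]
    generalize (∫ u in Ioi (0:ℝ), cexp (-z * ((√(X - 1) / √(X + 1) : ℝ):ℂ) * u - (u:ℂ)^2 / 2) * (u:ℂ)^(-μ)) = I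
    have hy := Real.sqrt_pos.2 hXm
    have hS : 0 < √(X + 1) := Real.sqrt_pos.2 (by linarith)
    have hd : 0 < √(X - 1) * √(X + 1) / 2 := by positivity
    have hld : Real.log (√(X - 1) * √(X + 1) / 2) = (2 * t + Real.log ((X^2 - 1) / (2 * X)) - Real.log 2) / 2 := by
      rw [← Real.sqrt_mul hXm.le, Real.log_div (Real.sqrt_pos.2 (by nlinarith)).ne' two_ne_zero, Real.log_sqrt (by nlinarith),
        Real.log_div hX2.ne' (by positivity), Real.log_mul two_ne_zero hX0.ne', hlog, show (X - 1) * (X + 1) = X^2 - 1 by ring]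
      ring
    have hc2 : (2:ℂ)^(μ/2) = cexp ((Real.log 2 : ℝ) * (μ/2)) := by
      rw [← aux_cpow 2 two_pos]; norm_num
    rw [aux_cpow X hX0, aux_cpow _ hd, aux_cpow _ (by positivity : 0 < (X^2 - 1) / (2 * X)), hc2, hld, hlog]
    have e1 : ((X / √(X - 1) : ℝ):ℂ) * ((X:ℝ):ℂ)⁻¹ * ((2 / √(X + 1) : ℝ):ℂ) * (((√(X - 1) * √(X + 1) / 2)⁻¹ : ℝ):ℂ)⁻¹ = 1 := by
      norm_cast
      field_simp
    have hXc : (X:ℂ) + 1 ≠ 0 := by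
      have : X + 1 ≠ 0 := by positivity
      exact_mod_cast this
    generalize Real.log ((X^2 - 1) / (2 * X)) = lS
    have e2 : cexp (((2 * t : ℝ):ℂ) * (1 - (1 - ν - μ))) * (cexp (z^2 / ((X + 1 : ℝ):ℂ)) *
        cexp ((((2 * t + lS - Real.log 2) / 2 : ℝ):ℂ) * (-μ))) =
        cexp ((Real.log 2 : ℝ) * (μ/2)) * cexp (z^2/2) * (cexp ((2 * ν + μ) * t - z^2/2 * (((X - 1) / (X + 1) : ℝ):ℂ)) *
          cexp ((lS:ℂ) * (-μ/2))) := by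
      rw [← Complex.exp_add, ← Complex.exp_add, ← Complex.exp_add, ← Complex.exp_add, ← Complex.exp_add]
      congr 1
      push_cast
      field_simp
      ring
    calc _ = (((X / √(X - 1) : ℝ):ℂ) * ((X:ℝ):ℂ)⁻¹ * ((2 / √(X + 1) : ℝ):ℂ) * (((√(X - 1) * √(X + 1) / 2)⁻¹ : ℝ):ℂ)⁻¹) *
        (cexp (((2 * t : ℝ):ℂ) * (1 - (1 - ν - μ))) * (cexp (z^2 / ((X + 1 : ℝ):ℂ)) *
        cexp ((((2 * t + lS - Real.log 2) / 2 : ℝ):ℂ) * (-μ)))) * Gamma (1 - ν - μ) * I := by ring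
      _ = _ := by rw [e1, e2]; ring
  replace L := L.trans (setIntegral_congr_fun measurableSet_Ioi hpt)
  rw [integral_const_mul] at L
  generalize (∫ t in Ioi (0:ℝ),
        Complex.exp ((2 * ν + μ) * t - z^2 / 2 * (Real.tanh t : ℝ)) *
          ((Real.sinh (2 * t) : ℝ) : ℂ) ^ (-μ/2) *
          (∫ u in Ioi (0:ℝ),
            Complex.exp (-z * (Real.sqrt (Real.tanh t) : ℝ) * u - (u:ℂ)^2 / 2) *
              (u:ℂ) ^ (-μ))) = J at L ⊢
  have h2 : (2:ℂ)^(-(1 - μ)) * (2:ℂ)^(1 - μ/2) = (2:ℂ)^(μ/2) := by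
    rw [← cpow_add _ _ two_ne_zero]; congr 1; ring
  have h2n : (2:ℂ)^(-(1 - μ)) ≠ 0 := by
    rw [Ne, cpow_eq_zero_iff]; simp
  rw [← h2] at L
  refine mul_left_cancel₀ (mul_ne_zero h2n hG) ?_
  rw [L]
  field_simp
end

section
/- Let ν, μ ∈ ℂ with Re ν < 0 and 0 < Re μ < 1, and let z ∈ ℂ. Then (1/Γ(1−ν−μ)) · [ (∫₀^∞ e^(−z·s − s²/2) s^(−ν−1) ds)·(∫₀^∞ e^(z·t − t²/2) t^(−ν−μ) dt) + (∫₀^∞ e^(z·s − s²/2) s^(−ν−1) ds)·(∫₀^∞ e^(−z·t − t²/2) t^(−ν−μ) dt) ] = (2√(2π)/Γ(1−μ/2)) · e^(z²/2) · ∫₀^∞ e^((2ν+μ)·t) · (sinh 2t)^(−μ/2) · ((√π/(Γ(μ/2)·Γ((1−μ)/2))) ∫₀^1 e^(−(z²/2)·tanh(t)·u) · u^(μ/2 −1) · (1−u)^(−(1+μ)/2) du) dt. (This is identity (53): D_ν(z)·D_(ν+μ−1)(−z) + D_ν(−z)·D_(ν+μ−1)(z) = (2√(2π)/(Γ(−ν)Γ(1−μ/2)))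 ∫₀^∞ e^((2ν+μ)t) (sinh 2t)^(−μ/2) Φ(μ/2, 1/2; −(z²/2) tanh t) dt, written with Φ replaced by its Euler integral and each D by its Laplace-integral representation.) -/
open MeasureTheory Complex Set

/-- Beta weight. -/
noncomputable def wgt (μ : ℂ) (u : ℝ) : ℂ :=
  (u:ℂ) ^ (μ/2 - 1) * ((1:ℂ) - (u:ℂ)) ^ (-(1 + μ)/2)

/-- base -/
noncomputable def bas (X u : ℝ) : ℂ := ((1 + X * u : ℝ) : ℂ)

lemma cpow_step {x : ℝ} (hx : 0 < x) (γ : ℂ) : (x:ℂ) ^ γ = (x:ℂ) ^ (γ - 1) * x := by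
  have hx' : (x:ℂ) ≠ 0 := by exact_mod_cast hx.ne'
  rw [Complex.cpow_sub _ _ hx', Complex.cpow_one, div_mul_cancel₀ _ hx']

lemma cpow_rd {f : ℝ → ℝ} {f' u : ℝ} (γ : ℂ) (hf : HasDerivAt f f' u) (hp : 0 < f u) :
    HasDerivAt (fun x => (f x : ℂ) ^ γ) (γ * (f u:ℂ)^(γ-1) * f') u := by
  have := (HasDerivAt.cpow_const (c := γ) (hasDerivAt_id ((f u : ℝ) : ℂ))
    (Complex.ofReal_mem_slitPlane.2 hp)).comp_ofReal.scomp u hf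
  refine HasDerivAt.congr_deriv this ?_
  simp; ring

lemma wgt_meas (μ : ℂ) : Measurable (wgt μ) := by
  unfold wgt; fun_prop

lemma wgt_integrable (μ : ℂ) (hμ0 : 0 < μ.re) (hμ1 : μ.re < 1) :
    IntegrableOn (wgt μ) (Ioo 0 1) := by
  have h := Complex.betaIntegral_convergent (u := μ/2) (v := (1-μ)/2)
    (by simpa using hμ0) (by simpa using hμ1)
  rw [intervalIntegrable_iff_integrableOn_Ioo_of_le zero_le_one] at h
  refine h.congr_fun (fun u hu => ?_) measurableSet_Ioo
  simp only [wgt]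
  congr 2
  ring

lemma wgt_integral (μ : ℂ) (hμ0 : 0 < μ.re) (hμ1 : μ.re < 1) :
    Complex.Gamma (μ/2) * Complex.Gamma ((1 - μ)/2) =
      ((Real.sqrt Real.pi : ℝ) : ℂ) * ∫ u in Ioo (0:ℝ) 1, wgt μ u := by
  rw [Complex.Gamma_mul_Gamma_eq_betaIntegral (by simpa using hμ0) (by simpa using hμ1)]
  have : μ/2 + (1-μ)/2 = 1/2 := by ring
  rw [this, Complex.Gamma_one_half_eq, Complex.betaIntegral,
    intervalIntegral.integral_of_le zero_le_one, integral_Ioc_eq_integral_Ioo]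
  congr 1
  · rw [Real.sqrt_eq_rpow, Complex.ofReal_cpow Real.pi_pos.le]; norm_num
  · refine setIntegral_congr_fun measurableSet_Ioo (fun u hu => ?_)
    simp only [wgt, Pi.mul_apply]
    congr 2
    ring

lemma bas_norm {X u : ℝ} (hX : 0 ≤ X) (hu : u ∈ Ioo (0:ℝ) 1) {γ : ℂ} (hγ : γ.re ≤ 0) :
    ‖bas X u ^ γ‖ ≤ 1 := by
  have h1 : 1 ≤ 1 + X * u := by have := mul_nonneg hX hu.1.le; linarith
  unfold bas
  rw [Complex.norm_cpow_eq_rpow_re_of_pos (by linarith)]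
  exact Real.rpow_le_one_of_one_le_of_nonpos h1 hγ

lemma bas_integrable {V : ℝ → ℂ} (hV : IntegrableOn V (Ioo 0 1)) {X : ℝ} (hX : 0 ≤ X)
    {γ : ℂ} (hγ : γ.re ≤ 0) : IntegrableOn (fun u => V u * bas X u ^ γ) (Ioo 0 1) := by
  refine Integrable.mul_bdd hV (c := 1) ?_ ?_
  · apply Measurable.aestronglyMeasurable
    unfold bas; fun_prop
  · filter_upwards [ae_restrict_mem measurableSet_Ioo] with u hu
    exact bas_norm hX hu hγ

lemma u_integrable {V : ℝ → ℂ} (hV : IntegrableOn V (Ioo 0 1)) :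
    IntegrableOn (fun u => V u * (u:ℂ)) (Ioo 0 1) := by
  refine Integrable.mul_bdd hV (c := 1) ?_ ?_
  · apply Measurable.aestronglyMeasurable
    fun_prop
  · filter_upwards [ae_restrict_mem measurableSet_Ioo] with u hu
    rw [Complex.norm_real, Real.norm_of_nonneg hu.1.le]
    exact hu.2.le

lemma param_deriv {V : ℝ → ℂ} (hV : IntegrableOn V (Ioo 0 1)) {γ : ℂ} (hγ : γ.re ≤ 0) (a : ℝ) :
    HasDerivAt (fun a : ℝ => ∫ u in Ioo (0:ℝ) 1, V u * bas (Real.sinh a ^ 2) u ^ γ)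
      (∫ u in Ioo (0:ℝ) 1, V u * (γ * bas (Real.sinh a ^ 2) u ^ (γ - 1) *
        ((2 * Real.sinh a * Real.cosh a * u : ℝ) : ℂ))) a := by
  have hγ' : (γ - 1).re ≤ 0 := by simp; linarith
  obtain ⟨M, hM⟩ := (isCompact_closedBall a 1).exists_bound_of_continuousOn
    (f := fun a => 2 * Real.sinh a * Real.cosh a)
    (Continuous.continuousOn (by fun_prop))
  refine (hasDerivAt_integral_of_dominated_loc_of_deriv_le (𝕜 := ℝ)
    (F := fun a u => V u * bas (Real.sinh a ^ 2) u ^ γ)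
    (F' := fun a u => V u * (γ * bas (Real.sinh a ^ 2) u ^ (γ - 1) *
        ((2 * Real.sinh a * Real.cosh a * u : ℝ) : ℂ)))
    (bound := fun u => ‖V u‖ * (‖γ‖ * M)) (Metric.ball_mem_nhds a one_pos) ?_ ?_ ?_ ?_ ?_ ?_).2
  · exact Filter.Eventually.of_forall fun x =>
      (bas_integrable hV (sq_nonneg _) hγ).aestronglyMeasurable
  · exact bas_integrable hV (sq_nonneg _) hγ
  · refine hV.aestronglyMeasurable.mul ?_
    apply Measurable.aestronglyMeasurable
    unfold bas; fun_prop
  · filter_upwards [ae_restrict_mem measurableSet_Ioo] with u hu x hx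
    rw [norm_mul, norm_mul, norm_mul]
    have h1 := bas_norm (sq_nonneg (Real.sinh x)) hu hγ'
    have h2 := hM x (Metric.ball_subset_closedBall hx)
    have h3 : ‖((2 * Real.sinh x * Real.cosh x * u : ℝ) : ℂ)‖ ≤ M := by
      rw [Complex.norm_real, norm_mul, Real.norm_of_nonneg hu.1.le]
      calc _ ≤ ‖2 * Real.sinh x * Real.cosh x‖ * 1 := by
            gcongr; exact hu.2.le
        _ ≤ M := by simpa using h2
    gcongr
    calc _ ≤ ‖γ‖ * 1 := by gcongr
      _ = ‖γ‖ := mul_one _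
  · exact hV.norm.mul_const _
  · filter_upwards [ae_restrict_mem measurableSet_Ioo] with u hu x hx
    refine HasDerivAt.const_mul _ ?_
    have hb : HasDerivAt (fun x : ℝ => 1 + Real.sinh x ^ 2 * u)
        (2 * Real.sinh x * Real.cosh x * u) x := by
      have := (((Real.hasDerivAt_sinh x).pow 2).mul_const u).const_add 1
      refine HasDerivAt.congr_deriv this ?_
      simp
    have hpos : 0 < 1 + Real.sinh x ^ 2 * u := by
      have := mul_nonneg (sq_nonneg (Real.sinh x)) hu.1.le; linarith
    exact cpow_rd γ hb hpos

lemma total_deriv (μ : ℂ) (hμ0 : 0 < μ.re) (hμ1 : μ.re < 1) {X : ℝ} (hX : 0 ≤ X) :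
    ∫ u in Ioo (0:ℝ) 1, wgt μ u * bas X u ^ (μ/2 - 2) *
      (μ + u * (-1 + 2 * (μ - 1) * X) + u * u * X * (1 - μ)) = 0 := by
  have hZ := bas_integrable (wgt_integrable μ hμ0 hμ1) hX (γ := μ/2 - 2) (by simp; linarith)
  have h1 := u_integrable hZ
  have h2 := u_integrable h1
  have hint : IntegrableOn (fun u : ℝ => wgt μ u * bas X u ^ (μ/2 - 2) *
      (μ + u * (-1 + 2 * (μ - 1) * X) + u * u * X * (1 - μ))) (Ioo 0 1) := by
    have := ((hZ.mul_const μ).add (h1.mul_const (-1 + 2 * (μ - 1) * X))).add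
      (h2.mul_const (X * (1-μ)))
    refine IntegrableOn.congr_fun this (fun u hu => ?_) measurableSet_Ioo
    simp only [Pi.add_apply]; ring
  have key := intervalIntegral.integral_eq_sub_of_hasDeriv_right_of_le (a := 0) (b := 1)
    (f := fun u : ℝ => 2 * ((u:ℂ) ^ (μ/2) * ((1 - u : ℝ) : ℂ) ^ ((1-μ)/2) * bas X u ^ (μ/2-1)))
    (f' := fun u : ℝ => wgt μ u * bas X u ^ (μ/2 - 2) *
      (μ + u * (-1 + 2 * (μ - 1) * X) + u * u * X * (1 - μ))) zero_le_one ?_ ?_ ?_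
  · rw [intervalIntegral.integral_of_le zero_le_one, integral_Ioc_eq_integral_Ioo] at key
    rw [key]
    have e1 : μ/2 ≠ 0 := by intro h; have := congrArg Complex.re h; simp at this; linarith
    have e2 : (1-μ)/2 ≠ 0 := by intro h; have := congrArg Complex.re h; simp at this; linarith
    simp [Complex.zero_cpow e1, Complex.zero_cpow e2]
  · refine ContinuousOn.const_smul (c := (2:ℂ)) (ContinuousOn.mul (ContinuousOn.mul ?_ ?_) ?_)
    · exact (Complex.continuous_ofReal_cpow_const (by simpa using hμ0)).continuousOn
    · exact ((Complex.continuous_ofReal_cpow_const (y := (1-μ)/2) (by simpa using hμ1)).comp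
        (g := fun x : ℝ => (x:ℂ) ^ ((1-μ)/2)) (f := fun u : ℝ => 1 - u)
        (by fun_prop)).continuousOn
    · unfold bas
      refine ContinuousOn.cpow (by fun_prop) (by fun_prop) (fun u hu => ?_)
      refine Complex.ofReal_mem_slitPlane.2 ?_
      have := mul_nonneg hX hu.1; linarith
  · intro u hu
    refine HasDerivAt.hasDerivWithinAt ?_
    have hu0 : (0:ℝ) < u := hu.1
    have hu1 : (0:ℝ) < 1 - u := by linarith [hu.2]
    have hB : 0 < 1 + X * u := by have := mul_nonneg hX hu0.le; linarith
    have d1 := cpow_rd (f := fun u => u) (μ/2) (hasDerivAt_id u) hu0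
    have d2 := cpow_rd (f := fun u => 1 - u) ((1-μ)/2) ((hasDerivAt_id u).const_sub 1) hu1
    have d3 := cpow_rd (f := fun u => 1 + X * u) (f' := X) (μ/2-1)
      (by simpa using ((hasDerivAt_id u).const_mul X).const_add 1) hB
    have := ((d1.mul d2).mul d3).const_mul (2:ℂ)
    unfold bas
    refine HasDerivAt.congr_deriv this ?_
    have c1 := cpow_step hu0 (μ/2)
    have c2 := cpow_step hu1 ((1-μ)/2)
    have c3 := cpow_step hB (μ/2-1)
    simp only [wgt, Pi.mul_apply]
    rw [c1, c2, c3]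
    have e1 : -(1+μ)/2 = (1-μ)/2 - 1 := by ring
    have e2 : μ/2 - 2 = μ/2 - 1 - 1 := by ring
    rw [e1, e2]
    push_cast
    ring
  · rw [intervalIntegrable_iff_integrableOn_Ioo_of_le zero_le_one]; exact hint

lemma cosh_formula (μ : ℂ) (hμ0 : 0 < μ.re) (hμ1 : μ.re < 1) (a : ℝ) :
    (Real.cosh a : ℂ) * ∫ u in Ioo (0:ℝ) 1, wgt μ u * bas (Real.sinh a ^ 2) u ^ (μ/2 - 1) =
      (∫ u in Ioo (0:ℝ) 1, wgt μ u) * ((cexp ((1 - μ) * a) + cexp (-((1-μ) * a))) / 2) := by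
  have hW := wgt_integrable μ hμ0 hμ1
  have hW1 : IntegrableOn (fun u => wgt μ u * (1 - (u:ℂ))) (Ioo 0 1) := by
    refine (hW.sub (u_integrable hW)).congr_fun (fun u hu => ?_) measurableSet_Ioo
    simp; ring
  have hγ : (μ/2-1).re ≤ 0 := by simp; linarith
  set c : ℂ := 1 - μ with hc
  let F : ℝ → ℂ := fun a => (Real.cosh a : ℂ) * ∫ u in Ioo (0:ℝ) 1, wgt μ u * bas (Real.sinh a ^ 2) u ^ (μ/2 - 1)
  let H : ℝ → ℂ := fun a => (Real.sinh a : ℂ) * ∫ u in Ioo (0:ℝ) 1, (wgt μ u * (1 - (u:ℂ))) * bas (Real.sinh a ^ 2) u ^ (μ/2 - 1)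
  have main : ∀ a, HasDerivAt F (c * H a) a ∧ HasDerivAt H (c * F a) a := by
    intro a
    have f1 := (Real.hasDerivAt_cosh a).ofReal_comp.mul (param_deriv hW hγ a)
    have f2 := (Real.hasDerivAt_sinh a).ofReal_comp.mul (param_deriv hW1 hγ a)
    set X : ℝ := Real.sinh a ^ 2 with hX
    have hX0 : 0 ≤ X := sq_nonneg _
    have hZ := bas_integrable hW hX0 (γ := μ/2 - 2) (by simp; linarith)
    have h1 := u_integrable hZ
    have h2 := u_integrable h1
    set m0 := ∫ u in Ioo (0:ℝ) 1, wgt μ u * bas X u ^ (μ/2 - 2) with hm0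
    set m1 := ∫ u in Ioo (0:ℝ) 1, wgt μ u * bas X u ^ (μ/2 - 2) * u with hm1
    set m2 := ∫ u in Ioo (0:ℝ) 1, wgt μ u * bas X u ^ (μ/2 - 2) * u * u with hm2
    have lin (A B C : ℂ) (f : ℝ → ℂ) (hf : ∀ u ∈ Ioo (0:ℝ) 1,
        f u = wgt μ u * bas X u ^ (μ/2 - 2) * A + wgt μ u * bas X u ^ (μ/2 - 2) * u * B +
          wgt μ u * bas X u ^ (μ/2 - 2) * u * u * C) :
        ∫ u in Ioo (0:ℝ) 1, f u = m0 * A + m1 * B + m2 * C := by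
      rw [setIntegral_congr_fun measurableSet_Ioo hf]
      have a1 := integral_add ((hZ.mul_const A).add (h1.mul_const B)) (h2.mul_const C)
      have a2 := integral_add (hZ.mul_const A) (h1.mul_const B)
      simp only [Pi.add_apply] at a1 a2
      rw [a1, a2]
      rw [integral_mul_const, integral_mul_const, integral_mul_const]
    have c3 : ∀ u ∈ Ioo (0:ℝ) 1, bas X u ^ (μ/2 - 1) = bas X u ^ (μ/2-2) * (1 + X * u) := by
      intro u hu
      have hB : 0 < 1 + X * u := by have := mul_nonneg hX0 hu.1.le; linarith
      have e2 : μ/2 - 2 = μ/2 - 1 - 1 := by ring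
      unfold bas
      rw [e2, cpow_step hB]
      push_cast
      rfl
    have T : m0 * μ + m1 * (-1 + 2 * (μ-1) * X) + m2 * (X * (1-μ)) = 0 := by
      rw [← total_deriv μ hμ0 hμ1 hX0]
      symm
      apply lin
      intro u hu; ring
    have i1 : ∫ u in Ioo (0:ℝ) 1, wgt μ u * bas X u ^ (μ/2 - 1) = m0 * 1 + m1 * X + m2 * 0 := by
      apply lin; intro u hu; rw [c3 u hu]; ring
    have i2 : ∫ u in Ioo (0:ℝ) 1, wgt μ u * (1 - (u:ℂ)) * bas X u ^ (μ/2 - 1) =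
        m0 * 1 + m1 * (X - 1) + m2 * (-X) := by
      apply lin; intro u hu; rw [c3 u hu]; ring
    have e2 : μ/2 - 1 - 1 = μ/2 - 2 := by ring
    have i3 : ∫ u in Ioo (0:ℝ) 1, wgt μ u * ((μ/2-1) * bas X u ^ (μ/2 - 1 - 1) *
        ((2 * Real.sinh a * Real.cosh a * u : ℝ) : ℂ)) = m0 * 0 +
        m1 * ((μ/2-1) * 2 * Real.sinh a * Real.cosh a) + m2 * 0 := by
      apply lin; intro u hu; rw [e2]; push_cast; ring
    have i4 : ∫ u in Ioo (0:ℝ) 1, wgt μ u * (1 - (u:ℂ)) * ((μ/2-1) * bas X u ^ (μ/2 - 1 - 1) *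
        ((2 * Real.sinh a * Real.cosh a * u : ℝ) : ℂ)) = m0 * 0 +
        m1 * ((μ/2-1) * 2 * Real.sinh a * Real.cosh a) +
        m2 * (-((μ/2-1) * 2 * Real.sinh a * Real.cosh a)) := by
      apply lin; intro u hu; rw [e2]; push_cast; ring
    rw [i3, i1] at f1
    rw [i4, i2] at f2
    have hXc : (X:ℂ) = (Real.sinh a:ℂ)^2 := by rw [hX]; push_cast; rfl
    have hC : (Real.cosh a:ℂ)^2 = 1 + (Real.sinh a:ℂ)^2 := by
      have := Real.cosh_sq a
      have h : ((Real.cosh a ^ 2 : ℝ):ℂ) = ((Real.sinh a^2 + 1 : ℝ):ℂ) := by rw [this]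
      push_cast at h ⊢
      rw [h]; ring
    constructor
    · refine HasDerivAt.congr_deriv f1 ?_
      symm
      show c * ((Real.sinh a : ℂ) * ∫ u in Ioo (0:ℝ) 1, (wgt μ u * (1 - (u:ℂ))) * bas (Real.sinh a ^ 2) u ^ (μ/2 - 1)) = _
      rw [← hX, i2, hc]
      rw [hXc] at T ⊢
      linear_combination (-Real.sinh a:ℂ) * T - (μ-2) * (Real.sinh a) * m1 * hC
    · refine HasDerivAt.congr_deriv f2 ?_
      symm
      show c * ((Real.cosh a : ℂ) * ∫ u in Ioo (0:ℝ) 1, (wgt μ u) * bas (Real.sinh a ^ 2) u ^ (μ/2 - 1)) = _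
      rw [← hX, i1, hc]
      rw [hXc] at T ⊢
      linear_combination (-Real.cosh a:ℂ) * T
  have e (κ : ℂ) (a : ℝ) : HasDerivAt (fun a : ℝ => cexp (κ * a)) (cexp (κ * a) * κ) a := by
    have := ((hasDerivAt_id (a:ℂ)).const_mul κ).cexp.comp_ofReal
    simpa using this
  have P := is_const_of_deriv_eq_zero (f := fun a => (F a + H a) * cexp (-c * a))
    (fun a => (((main a).1.add (main a).2).mul (e (-c) a)).differentiableAt)
    (fun a => by
      refine (((main a).1.add (main a).2).mul (e (-c) a)).deriv.trans ?_
      simp only [Pi.add_apply]; ring) a 0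
  have N := is_const_of_deriv_eq_zero (f := fun a => (F a - H a) * cexp (c * a))
    (fun a => (((main a).1.sub (main a).2).mul (e c a)).differentiableAt)
    (fun a => by
      refine (((main a).1.sub (main a).2).mul (e c a)).deriv.trans ?_
      simp only [Pi.sub_apply]; ring) a 0
  have F0 : F 0 = ∫ u in Ioo (0:ℝ) 1, wgt μ u := by simp [F, bas]
  have H0 : H 0 = 0 := by simp [H]
  simp only [F0, H0, ofReal_zero, mul_zero, Complex.exp_zero, add_zero, mul_one, sub_zero] at P N
  have E : cexp (c * a) * cexp (-c * a) = 1 := by rw [← Complex.exp_add]; simp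
  have e3 : -(c * (a:ℂ)) = -c * a := by ring
  show F a = _
  rw [e3]
  linear_combination (cexp (c*a)/2) * P + (cexp (-c*a)/2) * N - F a * E

lemma mconv {f g : ℝ → ℂ} (hfm : Measurable f) (hgm : Measurable g)
    (hf : IntegrableOn f (Ioi 0)) (hg : IntegrableOn g (Ioi 0)) :
    Integrable (fun q : ℝ × ℝ => f q.2 * g (q.1 / q.2) / q.2)
      ((volume.restrict (Ioi 0)).prod (volume.restrict (Ioi 0))) ∧
    (∫ s in Ioi (0:ℝ), f s) * (∫ t in Ioi (0:ℝ), g t) =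
      ∫ p in Ioi (0:ℝ), ∫ s in Ioi (0:ℝ), f s * g (p / s) / s := by
  have hint : Integrable (fun q : ℝ × ℝ => f q.2 * g (q.1 / q.2) / q.2)
      ((volume.restrict (Ioi 0)).prod (volume.restrict (Ioi 0))) := by
    rw [integrable_prod_iff' (Measurable.aestronglyMeasurable (by fun_prop))]
    constructor
    · filter_upwards [ae_restrict_mem measurableSet_Ioi] with s hs
      have hs0 : (0:ℝ) < s := hs
      have h := (integrableOn_Ioi_comp_mul_right_iff g 0 (inv_pos.2 hs0)).2 (by simpa using hg)
      have := (h.const_mul (f s)).div_const (s:ℂ)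
      exact this
    · have h2 := hf.norm.mul_const (∫ t in Ioi (0:ℝ), ‖g t‖)
      refine IntegrableOn.congr_fun h2 (fun s hs => ?_) measurableSet_Ioi
      have hs0 : (0:ℝ) < s := hs
      have h := integral_comp_mul_right_Ioi (fun t => ‖g t‖) 0 (inv_pos.2 hs0)
      simp only [norm_mul, norm_div, Complex.norm_real, Real.norm_of_nonneg hs0.le]
      rw [integral_div, integral_const_mul]
      simp only [div_eq_mul_inv]
      rw [h]
      simp
      field_simp
  refine ⟨hint, ?_⟩
  rw [integral_integral_swap (f := fun p s => f s * g (p/s) / s) hint, ← integral_mul_const]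
  refine setIntegral_congr_fun measurableSet_Ioi (fun s hs => ?_)
  have hs0 : (0:ℝ) < s := hs
  have h := integral_comp_mul_right_Ioi g 0 (inv_pos.2 hs0)
  beta_reduce
  rw [integral_div, integral_const_mul]
  simp only [div_eq_mul_inv] at h ⊢
  rw [h]
  simp
  have : (s:ℂ) ≠ 0 := by exact_mod_cast hs0.ne'
  field_simp

lemma lap_meas (z α : ℂ) : Measurable (fun s : ℝ => cexp (z * s - (s:ℂ)^2/2) * (s:ℂ)^α) := by
  fun_prop

lemma lap_int (z α : ℂ) (hα : -1 < α.re) :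
    IntegrableOn (fun s : ℝ => cexp (z * s - (s:ℂ)^2/2) * (s:ℂ)^α) (Ioi 0) := by
  have h := (integrableOn_rpow_mul_exp_neg_mul_sq (b := 1/4) (by norm_num) hα).const_mul
    (Real.exp (z.re^2))
  refine Integrable.mono' h (lap_meas z α).aestronglyMeasurable ?_
  filter_upwards [ae_restrict_mem measurableSet_Ioi] with s hs
  have hs0 : (0:ℝ) < s := hs
  rw [norm_mul, Complex.norm_cpow_eq_rpow_re_of_pos hs0, Complex.norm_exp]
  have e : (z * s - (s:ℂ)^2/2).re = z.re * s - s^2/2 := by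
    have : (s:ℂ)^2/2 = ((s^2/2:ℝ):ℂ) := by push_cast; rfl
    rw [this, Complex.sub_re, Complex.re_mul_ofReal, Complex.ofReal_re]
  rw [e]
  have : Real.exp (z.re * s - s^2/2) ≤ Real.exp (z.re^2) * Real.exp (-(1/4) * s^2) := by
    rw [← Real.exp_add]
    apply Real.exp_le_exp.2
    nlinarith [sq_nonneg (z.re - s/2)]
  calc _ ≤ (Real.exp (z.re^2) * Real.exp (-(1/4) * s^2)) * s ^ α.re := by gcongr
    _ = _ := by ring

lemma exp_cpow (x : ℝ) (α : ℂ) : ((Real.exp x : ℝ) : ℂ) ^ α = cexp (x * α) := by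
  rw [Complex.cpow_def_of_ne_zero (by exact_mod_cast (Real.exp_pos x).ne'),
    ← Complex.ofReal_log (Real.exp_pos x).le, Real.log_exp]

lemma s_sub (r : ℝ) (k : ℝ → ℂ) :
    ∫ s in Ioi (0:ℝ), k s = ∫ a : ℝ, (Real.exp (r - a) : ℂ) * k (Real.exp (r - a)) := by
  have him : (fun a : ℝ => Real.exp (r - a)) '' univ = Ioi 0 := by
    ext s; simp only [image_univ, mem_range, mem_Ioi]
    constructor
    · rintro ⟨a, rfl⟩; exact Real.exp_pos _
    · intro hs; exact ⟨r - Real.log s, by simp [Real.exp_log hs]⟩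
  have h := integral_image_eq_integral_abs_deriv_smul (s := univ)
    (f := fun a : ℝ => Real.exp (r - a)) (f' := fun a => - Real.exp (r - a)) MeasurableSet.univ
    (fun x _ => by
      have := ((hasDerivAt_id x).const_sub r).exp
      refine HasDerivAt.hasDerivWithinAt (HasDerivAt.congr_deriv this ?_)
      simp)
    (fun x _ y _ hxy => by
      have := Real.exp_injective hxy
      linarith) k
  rw [him] at h
  rw [h, setIntegral_univ]
  refine integral_congr_ae (Filter.Eventually.of_forall fun a => ?_)
  simp [abs_of_pos (Real.exp_pos _)]

lemma y_sub (c : ℝ) (hc : 0 < c) (k : ℝ → ℂ) :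
    ∫ y : ℝ, k y = ∫ a : ℝ, ((c * Real.cosh a : ℝ) : ℂ) * k (c * Real.sinh a) := by
  have him : (fun a : ℝ => c * Real.sinh a) '' univ = univ := by
    rw [image_univ]
    exact Function.Surjective.range_eq
      ((mul_left_surjective₀ hc.ne').comp Real.sinh_surjective)
  have h := integral_image_eq_integral_abs_deriv_smul (s := univ)
    (f := fun a : ℝ => c * Real.sinh a) (f' := fun a => c * Real.cosh a) MeasurableSet.univ
    (fun x _ => ((Real.hasDerivAt_sinh x).const_mul c).hasDerivWithinAt)
    (fun x _ y _ hxy => Real.sinh_injective (mul_left_cancel₀ hc.ne' hxy)) k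
  rw [him, setIntegral_univ, setIntegral_univ] at h
  rw [h]
  refine integral_congr_ae (Filter.Eventually.of_forall fun a => ?_)
  simp [abs_of_pos (Real.cosh_pos _), abs_of_pos hc]

lemma inner_p (ν μ z : ℂ) (hμ0 : 0 < μ.re) (hμ1 : μ.re < 1) {p : ℝ} (hp : 0 < p) :
    (∫ u in Ioo (0:ℝ) 1, wgt μ u) * (∫ s in Ioi (0:ℝ),
      ((cexp (-z * s - (s:ℂ)^2/2) * (s:ℂ)^(-ν-1)) *
        (cexp (z * (p/s:ℝ) - ((p/s:ℝ):ℂ)^2/2) * ((p/s:ℝ):ℂ)^(-ν-μ)) / s +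
       (cexp (-z * s - (s:ℂ)^2/2) * (s:ℂ)^(-ν-μ)) *
        (cexp (z * (p/s:ℝ) - ((p/s:ℝ):ℂ)^2/2) * ((p/s:ℝ):ℂ)^(-ν-1)) / s)) =
    ∫ y : ℝ, cexp (-p - (y:ℂ)^2/2 + z * y) * (p:ℂ)^(-ν-μ/2-1) *
      ∫ u in Ioo (0:ℝ) 1, wgt μ u * bas (y^2/(4*p)) u ^ (μ/2-1) := by
  obtain ⟨r, rfl⟩ : ∃ r, p = Real.exp (2 * r) := ⟨Real.log p / 2, by
    rw [mul_div_cancel₀ _ two_ne_zero, Real.exp_log hp]⟩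
  rw [y_sub (2 * Real.exp r) (by positivity), s_sub r, ← integral_const_mul]
  refine integral_congr_ae (Filter.Eventually.of_forall fun a => ?_)
  simp only []
  have ht : Real.exp (2*r) / Real.exp (r-a) = Real.exp (r+a) := by
    rw [← Real.exp_sub]; ring_nf
  have hX : (2 * Real.exp r * Real.sinh a)^2 / (4 * Real.exp (2*r)) = Real.sinh a ^ 2 := by
    have : Real.exp (2*r) = Real.exp r ^ 2 := by rw [← Real.exp_nat_mul]; norm_num
    rw [this]; field_simp; ring
  rw [ht, hX]
  have hs0 : ((Real.exp (r-a) : ℝ):ℂ) ≠ 0 := by exact_mod_cast (Real.exp_pos _).ne'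
  have hcf := cosh_formula μ hμ0 hμ1 a
  have hy : 2 * Real.exp r * Real.sinh a = Real.exp (r+a) - Real.exp (r-a) := by
    rw [Real.sinh_eq, Real.exp_add, sub_eq_add_neg r a, Real.exp_add]; ring
  have hst : Real.exp (2*r) = Real.exp (r-a) * Real.exp (r+a) := by
    rw [← Real.exp_add]; ring_nf
  have hexp : cexp (-(Real.exp (2*r):ℂ) - ((2 * Real.exp r * Real.sinh a : ℝ):ℂ)^2/2 +
      z * (2 * Real.exp r * Real.sinh a : ℝ)) =
      cexp (-z * Real.exp (r-a) - (Real.exp (r-a):ℂ)^2/2) *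
      cexp (z * Real.exp (r+a) - (Real.exp (r+a):ℂ)^2/2) := by
    rw [← Complex.exp_add, hy, hst, Complex.ofReal_sub, Complex.ofReal_mul]
    congr 1; ring
  rw [hexp]
  simp only [exp_cpow]
  have e1 : cexp ((r-a:ℝ) * (-ν-1)) * cexp ((r+a:ℝ) * (-ν-μ)) =
      cexp (r * (-2*ν-μ-1)) * cexp ((1-μ)*a) := by
    rw [← Complex.exp_add, ← Complex.exp_add]; push_cast; congr 1; ring
  have e2 : cexp ((r-a:ℝ) * (-ν-μ)) * cexp ((r+a:ℝ) * (-ν-1)) =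
      cexp (r * (-2*ν-μ-1)) * cexp (-((1-μ)*a)) := by
    rw [← Complex.exp_add, ← Complex.exp_add]; push_cast; congr 1; ring
  have e3 : (Real.exp r : ℂ) * cexp ((2*r:ℝ) * (-ν-μ/2-1)) = cexp (r * (-2*ν-μ-1)) := by
    rw [Complex.ofReal_exp, ← Complex.exp_add]; push_cast; congr 1; ring
  generalize (∫ u in Ioo (0:ℝ) 1, wgt μ u) = K at *
  generalize (∫ u in Ioo (0:ℝ) 1, wgt μ u * bas (Real.sinh a ^ 2) u ^ (μ/2-1)) = J at *
  generalize cexp (-z * Real.exp (r-a) - (Real.exp (r-a):ℂ)^2/2) = E1 at *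
  generalize cexp (z * Real.exp (r+a) - (Real.exp (r+a):ℂ)^2/2) = E2 at *
  generalize cexp ((r-a:ℝ) * (-ν-1)) = x1 at *
  generalize cexp ((r-a:ℝ) * (-ν-μ)) = x2 at *
  generalize cexp ((r+a:ℝ) * (-ν-1)) = x3 at *
  generalize cexp ((r+a:ℝ) * (-ν-μ)) = x4 at *
  generalize cexp ((2*r:ℝ) * (-ν-μ/2-1)) = x5 at *
  generalize ((Real.exp (r-a) : ℝ):ℂ) = s at *
  rw [Complex.ofReal_mul, Complex.ofReal_mul]
  have : K * (s * (E1 * x1 * (E2 * x4) / s + E1 * x2 * (E2 * x3) / s)) =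
      K * (E1 * E2 * (x1 * x4 + x2 * x3)) := by field_simp
  rw [this, e1, e2]
  rw [← e3]
  push_cast
  push_cast at hcf
  linear_combination (-2 * E1 * E2 * cexp r * x5) * hcf

lemma lhs_formula (ν μ z : ℂ) (hν : ν.re < 0) (hμ0 : 0 < μ.re) (hμ1 : μ.re < 1) :
    (∫ u in Ioo (0:ℝ) 1, wgt μ u) *
      ((∫ s in Ioi (0:ℝ), Complex.exp (-z * s - (s:ℂ)^2 / 2) * (s:ℂ) ^ (-ν - 1)) *
        (∫ t in Ioi (0:ℝ), Complex.exp (z * t - (t:ℂ)^2 / 2) * (t:ℂ) ^ (-ν - μ)) +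
       (∫ s in Ioi (0:ℝ), Complex.exp (z * s - (s:ℂ)^2 / 2) * (s:ℂ) ^ (-ν - 1)) *
        (∫ t in Ioi (0:ℝ), Complex.exp (-z * t - (t:ℂ)^2 / 2) * (t:ℂ) ^ (-ν - μ))) =
    ∫ p in Ioi (0:ℝ), ∫ y : ℝ, cexp (-p - (y:ℂ)^2/2 + z * y) * (p:ℂ)^(-ν-μ/2-1) *
      ∫ u in Ioo (0:ℝ) 1, wgt μ u * bas (y^2/(4*p)) u ^ (μ/2-1) := by
  have a1 : -1 < (-ν-1).re := by simp; linarith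
  have a2 : -1 < (-ν-μ).re := by simp; linarith
  obtain ⟨i1, h1⟩ := mconv (lap_meas (-z) (-ν-1)) (lap_meas z (-ν-μ)) (lap_int _ _ a1) (lap_int _ _ a2)
  obtain ⟨i2, h2⟩ := mconv (lap_meas (-z) (-ν-μ)) (lap_meas z (-ν-1)) (lap_int _ _ a2) (lap_int _ _ a1)
  rw [h1, mul_comm (∫ s in Ioi (0:ℝ), Complex.exp (z * s - (s:ℂ)^2 / 2) * (s:ℂ) ^ (-ν - 1)), h2]
  rw [← integral_add i1.integral_prod_left i2.integral_prod_left, ← integral_const_mul]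
  refine integral_congr_ae ?_
  filter_upwards [ae_restrict_mem measurableSet_Ioi, i1.prod_right_ae, i2.prod_right_ae] with p hp j1 j2
  rw [← inner_p ν μ z hμ0 hμ1 hp, ← integral_add j1 j2]

/-- The four-dimensional integrand. -/
noncomputable def Qf (ν μ z : ℂ) (x : (ℝ × ℝ) × (ℝ × ℝ)) : ℂ :=
  (((x.1.1:ℂ) ^ (-ν-μ) * cexp (-(((1 + x.2.1 : ℝ):ℂ) * x.1.1))) *
    cexp (-(((1 + x.2.1 * x.2.2 / 2)/2 : ℝ):ℂ) * (x.1.2:ℂ)^2 + z * x.1.2 + 0)) *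
  ((x.2.1:ℂ) ^ (-μ/2) * wgt μ x.2.2)

lemma Qf_meas (ν μ z : ℂ) : Measurable (Qf ν μ z) := by
  have := wgt_meas μ
  unfold Qf; fun_prop

/-- product measures -/
noncomputable def mPY : Measure (ℝ × ℝ) := (volume.restrict (Ioi 0)).prod volume
/-- product measures -/
noncomputable def mRU : Measure (ℝ × ℝ) := (volume.restrict (Ioi 0)).prod (volume.restrict (Ioo 0 1))

instance : SFinite mPY := by unfold mPY; infer_instance
instance : SFinite mRU := by unfold mRU; infer_instance

lemma ae_mRU : ∀ᵐ x ∂mRU, 0 < x.1 ∧ x.2 ∈ Ioo (0:ℝ) 1 := by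
  unfold mRU
  rw [Measure.prod_restrict]
  filter_upwards [ae_restrict_mem (measurableSet_Ioi.prod measurableSet_Ioo)] with x hx
  exact ⟨hx.1, hx.2⟩

lemma ae_mPY : ∀ᵐ x ∂mPY, 0 < x.1 := by
  unfold mPY
  rw [Measure.restrict_prod_eq_prod_univ]
  filter_upwards [ae_restrict_mem (measurableSet_Ioi.prod MeasurableSet.univ)] with x hx
  exact hx.1

lemma gam_int {n : ℂ} (hn : -1 < n.re) {r : ℝ} (hr : 0 < r) :
    IntegrableOn (fun p : ℝ => (p:ℂ) ^ n * cexp (-((r:ℂ) * p))) (Ioi 0) := by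
  have h := integrableOn_rpow_mul_exp_neg_mul_rpow (p := 1) hn one_pos hr
  refine Integrable.mono' h (Measurable.aestronglyMeasurable (by fun_prop)) ?_
  filter_upwards [ae_restrict_mem measurableSet_Ioi] with s hs
  have hs0 : (0:ℝ) < s := hs
  rw [norm_mul, Complex.norm_cpow_eq_rpow_re_of_pos hs0, Complex.norm_exp]
  simp

lemma rho_int {e k : ℝ} (he : e ≤ 0) (hk : -1 < k) (hek : e + k < -1) :
    IntegrableOn (fun ρ : ℝ => (1+ρ)^e * ρ^k) (Ioi 0) := by
  have hm : Measurable (fun ρ : ℝ => (1+ρ)^e * ρ^k) := by fun_prop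
  rw [← Ioc_union_Ioi_eq_Ioi zero_le_one, integrableOn_union]
  constructor
  · have h := (intervalIntegral.intervalIntegrable_rpow' (a := 0) (b := 1) hk)
    rw [intervalIntegrable_iff_integrableOn_Ioc_of_le zero_le_one] at h
    refine Integrable.mono' h hm.aestronglyMeasurable ?_
    filter_upwards [ae_restrict_mem measurableSet_Ioc] with s hs
    have hs0 : (0:ℝ) < s := hs.1
    rw [Real.norm_of_nonneg (by positivity)]
    have : (1+s)^e ≤ 1 := Real.rpow_le_one_of_one_le_of_nonpos (by linarith) he
    have h2 : 0 ≤ s^k := by positivity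
    nlinarith
  · have h := integrableOn_Ioi_rpow_of_lt hek one_pos
    refine Integrable.mono' h hm.aestronglyMeasurable ?_
    filter_upwards [ae_restrict_mem measurableSet_Ioi] with s hs
    have hs0 : (0:ℝ) < s := lt_trans one_pos hs
    rw [Real.norm_of_nonneg (by positivity), Real.rpow_add hs0]
    have : (1+s)^e ≤ s^e := Real.rpow_le_rpow_of_nonpos hs0 (by linarith) he
    gcongr

lemma wgt_norm (μ : ℂ) {u : ℝ} (hu : u ∈ Ioo (0:ℝ) 1) :
    ‖wgt μ u‖ = u^(μ.re/2-1) * (1-u)^(-(1+μ.re)/2) := by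
  have h1 : (0:ℝ) < 1 - u := by linarith [hu.2]
  unfold wgt
  have : (1:ℂ) - u = ((1-u:ℝ):ℂ) := by push_cast; rfl
  rw [this, norm_mul, Complex.norm_cpow_eq_rpow_re_of_pos hu.1, Complex.norm_cpow_eq_rpow_re_of_pos h1]
  simp

lemma wgt_int2 (μ : ℂ) (hμ1 : μ.re < 1) {ε : ℝ} (hε : ε < μ.re/2) :
    IntegrableOn (fun u : ℝ => u^(-ε) * ‖wgt μ u‖) (Ioo 0 1) := by
  have h := Complex.betaIntegral_convergent (u := ((μ.re/2-ε:ℝ):ℂ)) (v := ((1-μ.re)/2:ℝ))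
    (by rw [Complex.ofReal_re]; linarith) (by rw [Complex.ofReal_re]; linarith)
  rw [intervalIntegrable_iff_integrableOn_Ioo_of_le zero_le_one] at h
  refine IntegrableOn.congr_fun h.norm (fun u hu => ?_) measurableSet_Ioo
  have h1 : (0:ℝ) < 1 - u := by linarith [hu.2]
  have e : (1:ℂ) - u = ((1-u:ℝ):ℂ) := by push_cast; rfl
  rw [wgt_norm μ hu, e, norm_mul, Complex.norm_cpow_eq_rpow_re_of_pos hu.1,
    Complex.norm_cpow_eq_rpow_re_of_pos h1, ← mul_assoc, ← Real.rpow_add hu.1]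
  simp only [Complex.sub_re, Complex.ofReal_re, Complex.one_re]
  congr 2 <;> ring

lemma gauss_bound (c : ℝ) {B : ℝ} (hB : 1 ≤ B) :
    ∫ y : ℝ, Real.exp (-(B/2) * y^2 + c * y) ≤ Real.exp (c^2) * √(4 * Real.pi) * B^(-(1/2):ℝ) := by
  have hB0 : 0 < B := by linarith
  have hle : ∀ y : ℝ, Real.exp (-(B/2) * y^2 + c * y) ≤ Real.exp (c^2) * Real.exp (-(B/4) * y^2) := by
    intro y
    rw [← Real.exp_add]
    apply Real.exp_le_exp.2
    nlinarith [sq_nonneg (c - y/2), mul_nonneg (sub_nonneg.2 hB) (sq_nonneg y)]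
  have hi := (integrable_exp_neg_mul_sq (b := B/4) (by positivity)).const_mul (Real.exp (c^2))
  calc _ ≤ ∫ y : ℝ, Real.exp (c^2) * Real.exp (-(B/4) * y^2) := by
        refine integral_mono_of_nonneg (Filter.Eventually.of_forall fun y => (Real.exp_pos _).le)
          hi (Filter.Eventually.of_forall hle)
    _ = _ := by
        rw [integral_const_mul, integral_gaussian, mul_assoc]
        congr 1
        rw [Real.rpow_neg hB0.le, ← Real.sqrt_eq_rpow, ← Real.sqrt_inv, ← Real.sqrt_mul (by positivity)]
        congr 1
        field_simp

lemma B_bound {x ε : ℝ} (hx : 0 < x) (h0 : 0 < ε) (h1 : ε ≤ 1/2) :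
    (1 + x)^(-(1/2):ℝ) ≤ x^(-ε) := by
  calc (1+x)^(-(1/2):ℝ) ≤ (1+x)^(-ε) :=
        Real.rpow_le_rpow_of_exponent_le (by linarith) (by linarith)
    _ ≤ x^(-ε) := Real.rpow_le_rpow_of_nonpos hx (by linarith) (by linarith)

lemma Qf_integrable (ν μ z : ℂ) (hν : ν.re < 0) (hμ0 : 0 < μ.re) (hμ1 : μ.re < 1) :
    Integrable (Qf ν μ z) (mPY.prod mRU) := by
  have hn : -1 < (-ν-μ).re := by simp; linarith
  rw [integrable_prod_iff' (Qf_meas ν μ z).aestronglyMeasurable]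
  constructor
  · filter_upwards [ae_mRU] with x hx
    obtain ⟨hρ, hu⟩ := hx
    have hb : 0 < x.1 * x.2 := mul_pos hρ hu.1
    have h1 := gam_int hn (r := 1 + x.1) (by linarith)
    have h2 := integrable_cexp_quadratic (b := (((1 + x.1 * x.2 / 2)/2 : ℝ):ℂ))
      (by rw [Complex.ofReal_re]; linarith) z 0
    exact (Integrable.mul_prod h1 h2).mul_const ((x.1:ℂ)^(-μ/2) * wgt μ x.2)
  · obtain ⟨ε, hε0, hε1, hε2⟩ : ∃ ε : ℝ, 0 < ε ∧ ε < μ.re/2 ∧ ν.re + μ.re/2 < ε := by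
      refine ⟨max (μ.re/4) (μ.re/2 + ν.re/2), ?_, ?_, ?_⟩
      · exact lt_max_of_lt_left (by linarith)
      · exact max_lt (by linarith) (by linarith)
      · exact lt_max_of_lt_right (by linarith)
    have g1 := rho_int (e := ν.re + μ.re - 1) (k := -μ.re/2-ε) (by linarith) (by linarith) (by linarith)
    have g2 := wgt_int2 μ hμ1 hε1
    have g := (Integrable.mul_prod g1 g2).const_mul
      (Real.Gamma (1-ν.re-μ.re) * (Real.exp (z.re^2) * √(4 * Real.pi)) * (1/2:ℝ)^(-ε))
    refine Integrable.mono' g ?_ ?_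
    · exact (Qf_meas ν μ z).aestronglyMeasurable.prod_swap.norm.integral_prod_right'
    · filter_upwards [ae_mRU] with x hx
      obtain ⟨hρ, hu⟩ := hx
      obtain ⟨ρ, u⟩ := x
      simp only at hρ hu
      have hb : 0 < ρ * u := mul_pos hρ hu.1
      have hnorm : ∫ w, ‖Qf ν μ z (w, (ρ, u))‖ ∂mPY =
          (((1/(1+ρ))^(1-ν.re-μ.re) * Real.Gamma (1-ν.re-μ.re)) *
          (∫ y : ℝ, Real.exp (-((1 + ρ*u/2)/2) * y^2 + z.re * y))) * (ρ^(-μ.re/2) * ‖wgt μ u‖) := by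
        rw [← Real.integral_rpow_mul_exp_neg_mul_Ioi (by linarith) (by linarith), ← integral_prod_mul,
          ← integral_mul_const]
        refine integral_congr_ae ?_
        filter_upwards [ae_mPY] with w hp
        unfold Qf
        simp only [norm_mul]
        rw [Complex.norm_cpow_eq_rpow_re_of_pos hp, Complex.norm_cpow_eq_rpow_re_of_pos hρ,
          Complex.norm_exp, Complex.norm_exp]
        have e1 : (-(((1 + ρ : ℝ):ℂ) * w.1)).re = -((1+ρ) * w.1) := by
          rw [← Complex.ofReal_mul, ← Complex.ofReal_neg, Complex.ofReal_re]
        have e2 : (-(((1 + ρ * u / 2)/2 : ℝ):ℂ) * (w.2:ℂ)^2 + z * w.2 + 0).re =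
            -((1 + ρ*u/2)/2) * w.2^2 + z.re * w.2 := by
          rw [← Complex.ofReal_neg, ← Complex.ofReal_pow, ← Complex.ofReal_mul, add_zero,
            Complex.add_re, Complex.ofReal_re, Complex.re_mul_ofReal]
        have e3 : (-ν-μ).re = 1-ν.re-μ.re-1 := by simp; ring
        have e4 : (-μ/2).re = -μ.re/2 := by simp
        rw [e1, e2, e3, e4]
      rw [hnorm, Real.norm_of_nonneg]
      · have k1 := gauss_bound z.re (B := 1 + ρ*u/2) (by linarith)
        have k2 := B_bound (x := ρ*u/2) (by linarith) hε0 (by linarith)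
        have k3 : (1/(1+ρ))^(1-ν.re-μ.re) = (1+ρ)^(ν.re+μ.re-1) := by
          rw [one_div, Real.inv_rpow (by linarith), ← Real.rpow_neg (by linarith)]
          congr 1; ring
        have k4 : (ρ*u/2)^(-ε) = ρ^(-ε) * u^(-ε) * (1/2:ℝ)^(-ε) := by
          rw [← Real.mul_rpow hρ.le hu.1.le, ← Real.mul_rpow hb.le (by norm_num)]
          congr 1; ring
        have k5 : ρ^(-μ.re/2-ε) = ρ^(-μ.re/2) * ρ^(-ε) := by
          rw [← Real.rpow_add hρ]; rfl
        have hG : 0 < Real.Gamma (1-ν.re-μ.re) := Real.Gamma_pos_of_pos (by linarith)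
        have hpos : 0 < 1 + ρ := by linarith
        simp only []
        rw [k3, k5]
        calc _ ≤ (((1+ρ)^(ν.re+μ.re-1) * Real.Gamma (1-ν.re-μ.re)) *
              (Real.exp (z.re^2) * √(4 * Real.pi) * (ρ^(-ε) * u^(-ε) * (1/2:ℝ)^(-ε)))) *
              (ρ^(-μ.re/2) * ‖wgt μ u‖) := by
              rw [← k4]
              gcongr
              exact k1.trans (by gcongr)
          _ = _ := by ring
      · have hG : 0 < Real.Gamma (1-ν.re-μ.re) := Real.Gamma_pos_of_pos (by linarith)
        have hpos : 0 < 1 + ρ := by linarith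
        have : 0 ≤ ∫ y : ℝ, Real.exp (-((1 + ρ*u/2)/2) * y^2 + z.re * y) :=
          integral_nonneg fun y => (Real.exp_pos _).le
        positivity

lemma rho_integral (ν μ z : ℂ) (hμ1 : μ.re < 1) {p y u : ℝ} (hp : 0 < p) (hu : 0 < u) :
    ∫ ρ in Ioi (0:ℝ), Qf ν μ z ((p,y),(ρ,u)) =
    Complex.Gamma (1-μ/2) * (cexp (-p - (y:ℂ)^2/2 + z * y) * (p:ℂ)^(-ν-μ/2-1) *
      (wgt μ u * bas (y^2/(4*p)) u ^ (μ/2-1))) := by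
  have hX : 0 < 1 + y^2/(4*p)*u := by positivity
  have hpX : 0 < p + y^2*u/4 := by positivity
  have hG := Complex.integral_cpow_mul_exp_neg_mul_Ioi (a := 1-μ/2) (r := p + y^2*u/4)
    (by simp; linarith) hpX
  have e : ∀ ρ : ℝ, Qf ν μ z ((p,y),(ρ,u)) = ((p:ℂ)^(-ν-μ) * cexp (-p - (y:ℂ)^2/2 + z * y) * wgt μ u) *
      ((ρ:ℂ)^(1-μ/2-1) * cexp (-(((p + y^2*u/4 : ℝ):ℂ) * ρ))) := by
    intro ρ
    unfold Qf
    simp only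
    have : cexp (-(((1 + ρ : ℝ):ℂ) * p)) * cexp (-(((1 + ρ * u / 2)/2 : ℝ):ℂ) * (y:ℂ)^2 + z * y + 0)
        = cexp (-p - (y:ℂ)^2/2 + z * y) * cexp (-(((p + y^2*u/4 : ℝ):ℂ) * ρ)) := by
      rw [← Complex.exp_add, ← Complex.exp_add]
      congr 1; push_cast; ring
    rw [mul_assoc ((p:ℂ)^(-ν-μ)), this, show (-μ/2) = 1-μ/2-1 by ring]
    ring
  simp_rw [e]
  rw [integral_const_mul, hG]
  obtain ⟨a, rfl⟩ : ∃ a, p = Real.exp a := ⟨Real.log p, (Real.exp_log hp).symm⟩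
  obtain ⟨b, hb⟩ : ∃ b, 1 + y^2/(4*Real.exp a)*u = Real.exp b := ⟨Real.log _, (Real.exp_log hX).symm⟩
  have h3 : (1:ℂ)/((Real.exp a + y^2*u/4 : ℝ):ℂ) = ((Real.exp (-(a+b)) : ℝ):ℂ) := by
    have : Real.exp a + y^2*u/4 = Real.exp (a+b) := by
      rw [Real.exp_add, ← hb]
      field_simp
    rw [this, Real.exp_neg]; push_cast; rw [one_div]
  unfold bas
  rw [h3, hb, exp_cpow, exp_cpow, exp_cpow, exp_cpow]
  have h4 : cexp (a * (-ν-μ)) * cexp (((-(a+b) : ℝ):ℂ) * (1-μ/2)) =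
      cexp (a * (-ν-μ/2-1)) * cexp (b * (μ/2-1)) := by
    rw [← Complex.exp_add, ← Complex.exp_add]
    congr 1; push_cast; ring
  linear_combination (cexp (-(Real.exp a : ℝ) - (y:ℂ)^2/2 + z * y) * wgt μ u * Complex.Gamma (1-μ/2)) * h4

lemma C2 (ν μ z : ℂ) (hν : ν.re < 0) (hμ0 : 0 < μ.re) (hμ1 : μ.re < 1) :
    ∫ w, ∫ x, Qf ν μ z (w, x) ∂mRU ∂mPY =
    Complex.Gamma (1-μ/2) * ∫ p in Ioi (0:ℝ), ∫ y : ℝ,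
      cexp (-p - (y:ℂ)^2/2 + z * y) * (p:ℂ)^(-ν-μ/2-1) *
      ∫ u in Ioo (0:ℝ) 1, wgt μ u * bas (y^2/(4*p)) u ^ (μ/2-1) := by
  have hI := Qf_integrable ν μ z hν hμ0 hμ1
  have key : (fun w => ∫ x, Qf ν μ z (w, x) ∂mRU) =ᵐ[mPY] fun w =>
      Complex.Gamma (1-μ/2) * (cexp (-w.1 - (w.2:ℂ)^2/2 + z * w.2) * (w.1:ℂ)^(-ν-μ/2-1) *
      ∫ u in Ioo (0:ℝ) 1, wgt μ u * bas (w.2^2/(4*w.1)) u ^ (μ/2-1)) := by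
    filter_upwards [hI.prod_right_ae, ae_mPY] with w h hp
    obtain ⟨p, y⟩ := w
    unfold mRU at h ⊢
    rw [integral_prod_symm _ h, ← integral_const_mul, ← integral_const_mul]
    refine setIntegral_congr_fun measurableSet_Ioo (fun u hu => ?_)
    exact rho_integral ν μ z hμ1 hp hu.1
  have hG := hI.integral_prod_left.congr key
  rw [integral_congr_ae key]
  unfold mPY at hG ⊢
  rw [integral_prod _ hG]
  simp only [integral_const_mul]

lemma D0 (ν μ z : ℂ) (hν : ν.re < 0) (hμ1 : μ.re < 1) {ρ u : ℝ} (hρ : 0 < ρ) (hu : 0 < u) :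
    ∫ w, Qf ν μ z (w, (ρ,u)) ∂mPY =
    Complex.Gamma (1-ν-μ) * ((√(2*Real.pi) : ℝ):ℂ) * (((1+ρ : ℝ):ℂ)^(ν+μ-1) * (ρ:ℂ)^(-μ/2)) *
    (wgt μ u * ((1+ρ*u/2 : ℝ):ℂ)^(-(1/2):ℂ) * cexp (z^2/(2*((1+ρ*u/2 : ℝ):ℂ)))) := by
  have hb : 0 < 1+ρ*u/2 := by positivity
  have h1 := Complex.integral_cpow_mul_exp_neg_mul_Ioi (a := 1-ν-μ) (r := 1+ρ)
    (by simp; linarith) (by linarith)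
  have h2 := integral_cexp_quadratic (b := -(((1 + ρ * u / 2)/2 : ℝ):ℂ))
    (by rw [Complex.neg_re, Complex.ofReal_re]; linarith) z 0
  unfold Qf mPY
  simp only
  rw [integral_mul_const, integral_prod_mul (fun p : ℝ => (p:ℂ) ^ (-ν-μ) * cexp (-(((1 + ρ : ℝ):ℂ) * p)))
    (fun y : ℝ => cexp (-(((1 + ρ * u / 2)/2 : ℝ):ℂ) * (y:ℂ)^2 + z * y + 0)), h2]
  have h1' : ∫ p in Ioi (0:ℝ), (p:ℂ) ^ (-ν-μ) * cexp (-(((1 + ρ : ℝ):ℂ) * p)) =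
      (1/((1+ρ : ℝ):ℂ))^(1-ν-μ) * Complex.Gamma (1-ν-μ) := by
    rw [← h1]; congr 1; ext p; congr 2 <;> ring
  rw [h1']
  obtain ⟨a, ha⟩ : ∃ a, 1+ρ = Real.exp a := ⟨Real.log _, (Real.exp_log (by linarith)).symm⟩
  have h3 : (1:ℂ)/((1+ρ : ℝ):ℂ) = ((Real.exp (-a) : ℝ):ℂ) := by
    rw [ha, Real.exp_neg]; push_cast; rw [one_div]
  have h4 : ((1+ρ : ℝ):ℂ)^(ν+μ-1) = (1/((1+ρ : ℝ):ℂ))^(1-ν-μ) := by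
    rw [h3, ha, exp_cpow, exp_cpow]; congr 1; push_cast; ring
  have h5 : ((Real.pi:ℂ) / -(-(((1 + ρ * u / 2)/2 : ℝ):ℂ)))^(1/2:ℂ) =
      ((√(2*Real.pi) : ℝ):ℂ) * ((1+ρ*u/2 : ℝ):ℂ)^(-(1/2):ℂ) := by
    have t1 : ((Real.pi:ℂ) / -(-(((1 + ρ * u / 2)/2 : ℝ):ℂ))) =
        ((2*Real.pi * (1+ρ*u/2)⁻¹ : ℝ):ℂ) := by
      rw [neg_neg, ← Complex.ofReal_div]
      congr 1
      field_simp
    rw [t1]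
    have t2 : (1/2:ℂ) = ((1/2:ℝ):ℂ) := by push_cast; rfl
    rw [t2, ← Complex.ofReal_neg, ← Complex.ofReal_cpow (by positivity), ← Complex.ofReal_cpow hb.le,
      Real.mul_rpow (by positivity) (by positivity), Real.sqrt_eq_rpow, Real.inv_rpow hb.le, ← Real.rpow_neg hb.le,
      Complex.ofReal_mul]
  have h6 : cexp (0 - z^2/(4 * -(((1 + ρ * u / 2)/2 : ℝ):ℂ))) = cexp (z^2/(2*((1+ρ*u/2 : ℝ):ℂ))) := by
    congr 1
    have : ((1+ρ*u/2 : ℝ):ℂ) ≠ 0 := by exact_mod_cast hb.ne'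
    rw [Complex.ofReal_div]
    push_cast at this ⊢
    field_simp
    ring
  rw [h4, h5, h6]
  ring

lemma u_subst (μ z : ℂ) {c : ℝ} (hc : 0 < c) :
    ∫ u in Ioo (0:ℝ) 1, wgt μ u * ((1+c*u : ℝ):ℂ)^(-(1/2):ℂ) * cexp (z^2/(2*((1+c*u : ℝ):ℂ))) =
    cexp (z^2/2) * ((1+c : ℝ):ℂ)^(-μ/2) *
      ∫ v in Ioo (0:ℝ) 1, cexp (-(z^2/2) * ((c/(1+c) : ℝ):ℂ) * v) * wgt μ v := by
  have hR : 0 < 1 + c := by linarith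
  have hBp : ∀ u ∈ Ioo (0:ℝ) 1, 0 < 1 + c*u := fun u hu => by have := mul_pos hc hu.1; linarith
  have himg : (fun u : ℝ => u*(1+c)/(1+c*u)) '' Ioo (0:ℝ) 1 = Ioo 0 1 := by
    ext v
    constructor
    · rintro ⟨u, hu, rfl⟩
      have hB := hBp u hu
      have hu0 := hu.1
      have hu1 := hu.2
      refine ⟨by positivity, ?_⟩
      simp only
      rw [div_lt_one hB]; nlinarith
    · rintro ⟨h0, h1⟩
      have hd : 0 < 1 + c - c*v := by nlinarith
      refine ⟨v/(1+c-c*v), ⟨by positivity, ?_⟩, ?_⟩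
      · rw [div_lt_one hd]; nlinarith
      · have : 1 + c*(v/(1+c-c*v)) = (1+c)/(1+c-c*v) := by field_simp; ring
        simp only
        rw [this, div_mul_eq_mul_div, div_div_div_cancel_right₀ hd.ne', mul_div_assoc, div_self hR.ne', mul_one]
  have hinj : InjOn (fun u : ℝ => u*(1+c)/(1+c*u)) (Ioo 0 1) := by
    intro u hu w hw h
    have h1 := hBp u hu
    have h2 := hBp w hw
    simp only at h
    rw [div_eq_div_iff h1.ne' h2.ne'] at h
    have : (1+c) * (u - w) = 0 := by linear_combination h
    rcases mul_eq_zero.1 this with h | h <;> linarith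
  have hder : ∀ u ∈ Ioo (0:ℝ) 1, HasDerivWithinAt (fun u : ℝ => u*(1+c)/(1+c*u))
      ((1+c)/(1+c*u)^2) (Ioo 0 1) u := by
    intro u hu
    have hB := hBp u hu
    have h1 : HasDerivAt (fun u : ℝ => u*(1+c)) (1+c) u := by
      simpa using (hasDerivAt_id u).mul_const (1+c)
    have h2 : HasDerivAt (fun u : ℝ => 1+c*u) c u := by
      simpa using ((hasDerivAt_id u).const_mul c).const_add 1
    exact ((h1.div h2 hB.ne').congr_deriv (by ring)).hasDerivWithinAt
  have hs := integral_image_eq_integral_abs_deriv_smul measurableSet_Ioo hder hinj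
    (fun v : ℝ => cexp (-(z^2/2) * ((c/(1+c) : ℝ):ℂ) * v) * wgt μ v)
  rw [himg] at hs
  rw [hs, ← integral_const_mul]
  refine setIntegral_congr_fun measurableSet_Ioo (fun u hu => ?_)
  have hB := hBp u hu
  have hu1 : 0 < 1 - u := by linarith [hu.2]
  rw [abs_of_pos (by positivity), Complex.real_smul]
  have hE : cexp (z^2/2) * cexp (-(z^2/2) * ((c/(1+c) : ℝ):ℂ) * ((u*(1+c)/(1+c*u) : ℝ):ℂ)) =
      cexp (z^2/(2*((1+c*u : ℝ):ℂ))) := by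
    rw [← Complex.exp_add]
    congr 1
    have h1 : ((1+c*u : ℝ):ℂ) ≠ 0 := by exact_mod_cast hB.ne'
    have h2 : ((1+c : ℝ):ℂ) ≠ 0 := by exact_mod_cast hR.ne'
    push_cast at h1 h2 ⊢
    field_simp
    ring
  have hW : ((1+c : ℝ):ℂ)^(-μ/2) * ((((1+c)/(1+c*u)^2 : ℝ):ℂ) * wgt μ (u*(1+c)/(1+c*u))) =
      wgt μ u * ((1+c*u : ℝ):ℂ)^(-(1/2):ℂ) := by
    have e1 : (1:ℂ) - ((u*(1+c)/(1+c*u) : ℝ):ℂ) = (((1-u)/(1+c*u) : ℝ):ℂ) := by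
      rw [← Complex.ofReal_one, ← Complex.ofReal_sub]
      congr 1
      rw [eq_div_iff hB.ne', sub_mul, div_mul_cancel₀ _ hB.ne']; ring
    have e2 : (1:ℂ) - (u:ℂ) = ((1-u : ℝ):ℂ) := by push_cast; rfl
    unfold wgt
    rw [e1, e2]
    have hu0 := hu.1
    obtain ⟨r, hr⟩ : ∃ r, 1+c = Real.exp r := ⟨Real.log _, (Real.exp_log hR).symm⟩
    obtain ⟨b, hb⟩ : ∃ b, 1+c*u = Real.exp b := ⟨Real.log _, (Real.exp_log hB).symm⟩
    obtain ⟨q, hq⟩ : ∃ q, 1-u = Real.exp q := ⟨Real.log _, (Real.exp_log hu1).symm⟩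
    obtain ⟨s, hs⟩ : ∃ s, u = Real.exp s := ⟨Real.log _, (Real.exp_log hu0).symm⟩
    rw [hb, hr, hq]
    have f1 : u * Real.exp r / Real.exp b = Real.exp (s+r-b) := by
      rw [Real.exp_sub, Real.exp_add, ← hs]
    have f2 : Real.exp q / Real.exp b = Real.exp (q-b) := by rw [Real.exp_sub]
    have f3 : Real.exp r / Real.exp b^2 = Real.exp (r-2*b) := by
      rw [Real.exp_sub, two_mul, Real.exp_add, sq]
    have f4 : (u:ℂ) = ((Real.exp s : ℝ):ℂ) := by rw [← hs]
    rw [f1, f2, f3, f4]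
    simp only [exp_cpow]
    rw [Complex.ofReal_exp (r-2*b)]
    simp only [← Complex.exp_add]
    congr 1
    push_cast
    ring
  rw [← hE, ← hW]
  ring

lemma t_subst (ν μ : ℂ) (H : ℝ → ℂ) :
    ∫ ρ in Ioi (0:ℝ), (((1+ρ : ℝ):ℂ)^(ν+μ-1) * (ρ:ℂ)^(-μ/2)) *
      (((1+ρ/2 : ℝ):ℂ)^(-μ/2) * H ((ρ/2)/(1+ρ/2))) =
    2 * ∫ t in Ioi (0:ℝ), cexp ((2*ν+μ)*t) * ((Real.sinh (2*t) : ℝ):ℂ)^(-μ/2) * H (Real.tanh t) := by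
  have himg : (fun t : ℝ => Real.exp (2*t) - 1) '' Ioi (0:ℝ) = Ioi 0 := by
    ext v
    constructor
    · rintro ⟨u, hu, rfl⟩
      have hu : 0 < u := hu
      have : 1 < Real.exp (2*u) := Real.one_lt_exp_iff.2 (by linarith)
      simp only [mem_Ioi]; linarith
    · intro h0
      have h0 : 0 < v := h0
      refine ⟨Real.log (1+v)/2, ?_, ?_⟩
      · have := Real.log_pos (x := 1+v) (by linarith)
        simp only [mem_Ioi]; linarith
      · simp only
        rw [mul_div_cancel₀ _ two_ne_zero, Real.exp_log (by linarith)]; ring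
  have hinj : InjOn (fun t : ℝ => Real.exp (2*t) - 1) (Ioi 0) := by
    intro u hu w hw h
    simp only at h
    have : Real.exp (2*u) = Real.exp (2*w) := by linarith
    have := Real.exp_injective this
    linarith
  have hder : ∀ u ∈ Ioi (0:ℝ), HasDerivWithinAt (fun t : ℝ => Real.exp (2*t) - 1)
      (2 * Real.exp (2*u)) (Ioi 0) u := by
    intro u hu
    have h2 : HasDerivAt (fun u : ℝ => 2*u) 2 u := by
      simpa using ((hasDerivAt_id u).const_mul 2)
    exact ((h2.exp.sub_const 1).congr_deriv (by ring)).hasDerivWithinAt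
  have hs := integral_image_eq_integral_abs_deriv_smul measurableSet_Ioi hder hinj
    (fun ρ : ℝ => (((1+ρ : ℝ):ℂ)^(ν+μ-1) * (ρ:ℂ)^(-μ/2)) *
      (((1+ρ/2 : ℝ):ℂ)^(-μ/2) * H ((ρ/2)/(1+ρ/2))))
  rw [himg] at hs
  rw [hs, ← integral_const_mul]
  refine setIntegral_congr_fun measurableSet_Ioi (fun t ht => ?_)
  have ht : 0 < t := ht
  rw [abs_of_pos (by positivity), Complex.real_smul]
  have hE : Real.exp (2*t) = Real.exp t * Real.exp t := by rw [two_mul, Real.exp_add]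
  have hinv : Real.exp (-t) * Real.exp t = 1 := by rw [← Real.exp_add]; simp
  have hc : Real.exp (2*t) - 1 = 2 * (Real.exp t * Real.sinh t) := by
    rw [Real.sinh_eq]; linear_combination hE + hinv
  have hR : 1 + (Real.exp (2*t) - 1)/2 = Real.exp t * Real.cosh t := by
    rw [Real.cosh_eq]; linear_combination hE/2 - hinv/2
  have hsh : 0 < Real.sinh t := Real.sinh_pos_iff.2 ht
  have hch := Real.cosh_pos t
  have hsh2 : 0 < Real.sinh (2*t) := Real.sinh_pos_iff.2 (by linarith)
  have hT : (Real.exp (2*t) - 1)/2/(1 + (Real.exp (2*t) - 1)/2) = Real.tanh t := by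
    rw [hR, hc, Real.tanh_eq_sinh_div_cosh]
    have := Real.exp_pos t
    field_simp
  rw [hT]
  have hP : ((Real.exp (2*t) - 1 : ℝ):ℂ)^(-μ/2) * ((1 + (Real.exp (2*t) - 1)/2 : ℝ):ℂ)^(-μ/2) =
      cexp ((2*t:ℝ) * (-μ/2)) * ((Real.sinh (2*t) : ℝ):ℂ)^(-μ/2) := by
    have hex := Real.exp_pos t
    rw [← exp_cpow, ← Complex.mul_cpow_ofReal_nonneg (by rw [hc]; positivity) (by rw [hR]; positivity),
      ← Complex.mul_cpow_ofReal_nonneg (by positivity) hsh2.le, ← Complex.ofReal_mul, ← Complex.ofReal_mul]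
    congr 2
    rw [hR, hc, Real.sinh_two_mul, hE]; ring
  have hL : ((1 + (Real.exp (2*t) - 1) : ℝ):ℂ)^(ν+μ-1) = cexp ((2*t:ℝ) * (ν+μ-1)) := by
    rw [← exp_cpow]; congr 2; ring
  have hX : ((Real.exp (2*t) : ℝ):ℂ) * cexp ((2*t:ℝ) * (ν+μ-1)) * cexp ((2*t:ℝ) * (-μ/2)) = cexp ((2*ν+μ)*t) := by
    rw [Complex.ofReal_exp, ← Complex.exp_add, ← Complex.exp_add]
    congr 1; push_cast; ring
  rw [hL, ← hX]
  rw [Complex.ofReal_mul]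
  push_cast at hP ⊢
  linear_combination (2 * cexp (2*t) * cexp (2*t * (ν+μ-1)) * H (Real.tanh t)) * hP

lemma D2 (ν μ z : ℂ) (hν : ν.re < 0) (hμ0 : 0 < μ.re) (hμ1 : μ.re < 1) :
    ∫ w, ∫ x, Qf ν μ z (w, x) ∂mRU ∂mPY =
    Complex.Gamma (1-ν-μ) * ((√(2*Real.pi) : ℝ):ℂ) * cexp (z^2/2) * (2 * ∫ t in Ioi (0:ℝ),
      cexp ((2*ν+μ)*t) * ((Real.sinh (2*t) : ℝ):ℂ)^(-μ/2) *
      ∫ v in Ioo (0:ℝ) 1, cexp (-(z^2/2) * (Real.tanh t : ℝ) * v) * wgt μ v) := by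
  have hI := Qf_integrable ν μ z hν hμ0 hμ1
  rw [integral_integral_swap (f := fun w x => Qf ν μ z (w, x)) hI]
  have key : (fun x => ∫ w, Qf ν μ z (w, x) ∂mPY) =ᵐ[mRU] fun x =>
      Complex.Gamma (1-ν-μ) * ((√(2*Real.pi) : ℝ):ℂ) * (((1+x.1 : ℝ):ℂ)^(ν+μ-1) * (x.1:ℂ)^(-μ/2)) *
    (wgt μ x.2 * ((1+x.1*x.2/2 : ℝ):ℂ)^(-(1/2):ℂ) * cexp (z^2/(2*((1+x.1*x.2/2 : ℝ):ℂ)))) := by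
    filter_upwards [ae_mRU] with x hx
    exact D0 ν μ z hν hμ1 hx.1 hx.2.1
  have hG := hI.integral_prod_right.congr key
  rw [integral_congr_ae key]
  unfold mRU at hG ⊢
  rw [integral_prod _ hG,
    ← t_subst ν μ (fun τ => ∫ v in Ioo (0:ℝ) 1, cexp (-(z^2/2) * (τ : ℝ) * v) * wgt μ v),
    ← integral_const_mul]
  refine setIntegral_congr_fun measurableSet_Ioi (fun ρ hρ => ?_)
  have hρ : 0 < ρ := hρ
  have hs := u_subst μ z (c := ρ/2) (by linarith)
  simp only
  rw [integral_const_mul]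
  simp only [div_mul_eq_mul_div] at hs ⊢
  rw [hs]
  ring

lemma final_alg {G1 G2 S E J K L P : ℂ} (h1 : G1 ≠ 0) (h2 : G2 ≠ 0) (hK : K ≠ 0) (hP : P ≠ 0)
    (h : G1 * S * E * (2 * J) = G2 * (K * L)) :
    1 / G1 * L = 2 * S / G2 * E * (P / (P * K) * J) := by
  field_simp
  linear_combination -h


/-- Identity (53): `D_ν(z) D_(ν+μ-1)(-z) + D_ν(-z) D_(ν+μ-1)(z)
= (2√(2π)/(Γ(-ν)Γ(1-μ/2))) ∫₀^∞ e^((2ν+μ)t) (sinh 2t)^(-μ/2) Φ(μ/2, 1/2; -(z²/2) tanh t) dt`,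
with Φ replaced by its Euler integral and each D by its Laplace-integral representation. -/
theorem nicholson_type_integral_even_part
    (ν μ z : ℂ) (hν : ν.re < 0) (hμ0 : 0 < μ.re) (hμ1 : μ.re < 1) :
    (1 / Complex.Gamma (1 - ν - μ)) *
      ((∫ s in Ioi (0:ℝ), Complex.exp (-z * s - (s:ℂ)^2 / 2) * (s:ℂ) ^ (-ν - 1)) *
        (∫ t in Ioi (0:ℝ), Complex.exp (z * t - (t:ℂ)^2 / 2) * (t:ℂ) ^ (-ν - μ)) +
       (∫ s in Ioi (0:ℝ), Complex.exp (z * s - (s:ℂ)^2 / 2) * (s:ℂ) ^ (-ν - 1)) *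
        (∫ t in Ioi (0:ℝ), Complex.exp (-z * t - (t:ℂ)^2 / 2) * (t:ℂ) ^ (-ν - μ))) =
    (2 * ((Real.sqrt (2 * Real.pi) : ℝ) : ℂ) / Complex.Gamma (1 - μ/2)) *
      Complex.exp (z^2 / 2) *
      ∫ t in Ioi (0:ℝ),
        Complex.exp ((2 * ν + μ) * t) * ((Real.sinh (2 * t) : ℝ) : ℂ) ^ (-μ/2) *
          ((((Real.sqrt Real.pi : ℝ) : ℂ) /
              (Complex.Gamma (μ/2) * Complex.Gamma ((1 - μ)/2))) *
            ∫ u in Ioo (0:ℝ) 1,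
              Complex.exp (-(z^2 / 2) * (Real.tanh t : ℝ) * u) *
                (u:ℂ) ^ (μ/2 - 1) * ((1:ℂ) - (u:ℂ)) ^ (-(1 + μ)/2)) := by
  have h1 := lhs_formula ν μ z hν hμ0 hμ1
  have h2 := C2 ν μ z hν hμ0 hμ1
  rw [← h1, D2 ν μ z hν hμ0 hμ1] at h2
  have hw := wgt_integral μ hμ0 hμ1
  have g1 : Complex.Gamma (1 - ν - μ) ≠ 0 :=
    Complex.Gamma_ne_zero_of_re_pos (by simp; linarith)
  have g2 : Complex.Gamma (1 - μ/2) ≠ 0 :=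
    Complex.Gamma_ne_zero_of_re_pos (by simp; linarith)
  have g3 : Complex.Gamma (μ/2) ≠ 0 :=
    Complex.Gamma_ne_zero_of_re_pos (by simp; linarith)
  have g4 : Complex.Gamma ((1 - μ)/2) ≠ 0 :=
    Complex.Gamma_ne_zero_of_re_pos (by simp; linarith)
  have e : ∀ t : ℝ, (∫ u in Ioo (0:ℝ) 1, Complex.exp (-(z^2 / 2) * (Real.tanh t : ℝ) * u) *
      (u:ℂ) ^ (μ/2 - 1) * ((1:ℂ) - (u:ℂ)) ^ (-(1 + μ)/2)) =
      ∫ u in Ioo (0:ℝ) 1, cexp (-(z^2/2) * (Real.tanh t : ℝ) * u) * wgt μ u := by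
    intro t
    unfold wgt
    simp only [mul_assoc]
  simp only [e]
  rw [hw]
  have hK : ((Real.sqrt Real.pi : ℝ) : ℂ) * (∫ u in Ioo (0:ℝ) 1, wgt μ u) ≠ 0 := by
    rw [← hw]; exact mul_ne_zero g3 g4
  have hpi := left_ne_zero_of_mul hK
  have hK := right_ne_zero_of_mul hK
  have e2 : ∀ a c J : ℂ, a * (c * J) = c * (a * J) := fun a c J => by ring
  simp only [e2 _ (((Real.sqrt Real.pi : ℝ) : ℂ) / _)]
  rw [integral_const_mul]
  exact final_alg g1 g2 hK hpi h2
end
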